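/- Let 0 < α < 1 and β ∈ [0,1]. There exists a constant c > 0, depending only on α and β, with the following property. Let V be a nontrivial finite-dimensional complex inner product space, A : V → V a self-adjoint positive definite linear operator, v ∈ V, and let u : [0,∞) → V be continuous with u(0) = v, differentiable on (0,∞), such that for every t > 0 the function s ↦ (t-s)^{-α} ‖u'(s)‖ is integrable on (0,t) and ∂_t^α u(t) + A u(t) = 0, where ∂_t^α u(t) = (1/Γ(1-α)) ∫_0^t (t-s)^{-α} u'(s) ds. Let y(t) = u(t) - v and g(t_n) = ∂_t^α u(t_n) - τ^{-α} Σ_{j=0}^n b_j^{(α)} y(t_{n-j}). Then for every τ > 0 and every integer n ≥ 2, ‖A^{-β} ( g(t_n) - g(t_{n-1}) ) / τ‖ ≤ c · τ · t_n^{-2 - (1-β)α} · ‖v‖, where t_k = kτ. -/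

import Mathlib

open scoped ComplexInnerProductSpace

/-- The backward Euler convolution quadrature weights `b_j^(α) = (-1)^j binom(α, j)`. -/
noncomputable def cqWeight (α : ℝ) (j : ℕ) : ℝ :=
  (-1 : ℝ) ^ j * (∏ i ∈ Finset.range j, (α - i)) / (Nat.factorial j)

/-- The Caputo derivative `∂_t^α u(t) = (1/Γ(1-α)) ∫_0^t (t-s)^{-α} u'(s) ds`,
expressed through the derivative function `u'`. -/
noncomputable def caputo (α : ℝ) {V : Type} [NormedAddCommGroup V] [NormedSpace ℝ V]
    (u' : ℝ → V) (t : ℝ) : V :=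
  (1 / Real.Gamma (1 - α)) • ∫ s in Set.Ioo 0 t, ((t - s) ^ (-α) : ℝ) • u' s

/-- The consistency error `g(t_n) = ∂_t^α u(t_n) - ∂̄_τ^α y(t_n)` of the backward Euler CQ,
where `y = u - v`. -/
noncomputable def cqError (α : ℝ) {V : Type} [NormedAddCommGroup V] [NormedSpace ℝ V]
    (τ : ℝ) (u u' : ℝ → V) (v : V) (n : ℕ) : V :=
  caputo α u' ((n : ℝ) * τ)
    - τ ^ (-α) • ∑ j ∈ Finset.range (n + 1), cqWeight α j • (u (((n - j : ℕ) : ℝ) * τ) - v)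

/-- Fractional power `A^β` via the functional (spectral) calculus. -/
noncomputable def opRPow {V : Type} [NormedAddCommGroup V] [InnerProductSpace ℂ V]
    [FiniteDimensional ℂ V] (A : V →L[ℂ] V) (β : ℝ) : V →L[ℂ] V :=
  cfc (fun x : ℝ => x ^ β) A

/-- Integrability and value of the real beta integral on `(0, t)`. -/
theorem integral_Ioo_rpow_mul_rpow {a b t : ℝ} (ha : 0 < a) (hb : 0 < b) (ht : 0 < t) :
    MeasureTheory.IntegrableOn (fun s => (t - s) ^ (a - 1) * s ^ (b - 1)) (Set.Ioo 0 t) ∧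
      ∫ s in Set.Ioo 0 t, (t - s) ^ (a - 1) * s ^ (b - 1)
        = t ^ (a + b - 1) * (Real.Gamma a * Real.Gamma b / Real.Gamma (a + b)) := by
  have hinv : (∫ s in Set.Ioo 0 t, (t - s) ^ (a - 1) * s ^ (b - 1))
        = t ^ (a + b - 1) * (Real.Gamma a * Real.Gamma b / Real.Gamma (a + b)) := by
    have h := Complex.betaIntegral_scaled (b : ℂ) (a : ℂ) ht
    have hB : Complex.betaIntegral (b : ℂ) (a : ℂ)
        = ((Real.Gamma a * Real.Gamma b / Real.Gamma (a + b) : ℝ) : ℂ) := by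
      have := Complex.Gamma_mul_Gamma_eq_betaIntegral (s := (b : ℂ)) (t := (a : ℂ))
        (by simpa using hb) (by simpa using ha)
      rw [← Complex.ofReal_add, Complex.Gamma_ofReal, Complex.Gamma_ofReal,
        Complex.Gamma_ofReal] at this
      have hne : Real.Gamma (b + a) ≠ 0 := (Real.Gamma_pos_of_pos (by positivity)).ne'
      have hneC : (Real.Gamma (b + a) : ℂ) ≠ 0 := by exact_mod_cast hne
      rw [add_comm a b]
      push_cast
      rw [mul_comm (Real.Gamma a : ℂ), this]
      field_simp
    rw [hB] at h
    have h2 : (∫ x in (0 : ℝ)..t, (x : ℂ) ^ ((b : ℂ) - 1) * ((t : ℂ) - x) ^ ((a : ℂ) - 1))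
        = ∫ x in (0 : ℝ)..t, (((t - x) ^ (a - 1) * x ^ (b - 1) : ℝ) : ℂ) := by
      refine intervalIntegral.integral_congr fun x hx => ?_
      rw [Set.uIcc_of_le ht.le] at hx
      have h1 : 0 ≤ t - x := sub_nonneg.2 hx.2
      push_cast
      rw [Complex.ofReal_cpow h1, Complex.ofReal_cpow hx.1]
      push_cast
      ring
    rw [h2, intervalIntegral.integral_ofReal] at h
    rw [← MeasureTheory.integral_Ioc_eq_integral_Ioo, ← intervalIntegral.integral_of_le ht.le]
    have h3 : ((t : ℂ) ^ ((b : ℂ) + a - 1)) = ((t ^ (a + b - 1) : ℝ) : ℂ) := by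
      rw [Complex.ofReal_cpow ht.le]
      push_cast
      ring_nf
    rw [h3] at h
    exact_mod_cast h
  refine ⟨?_, hinv⟩
  have hpos : (0 : ℝ) < ∫ s in Set.Ioo 0 t, (t - s) ^ (a - 1) * s ^ (b - 1) := by
    rw [hinv]
    have := Real.Gamma_pos_of_pos ha
    have := Real.Gamma_pos_of_pos hb
    have := Real.Gamma_pos_of_pos (add_pos ha hb)
    positivity
  by_contra hni
  rw [MeasureTheory.integral_undef hni] at hpos
  exact lt_irrefl _ hpos

theorem Gamma_le_Gamma_add_mul {y α : ℝ} (hy : 0 < y) (h0 : 0 < α) (h1 : α < 1) :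
    y * Real.Gamma y ≤ Real.Gamma (y + α) * (y + α) ^ (1 - α) := by
  have h := Real.Gamma_mul_add_mul_le_rpow_Gamma_mul_rpow_Gamma (s := y + α) (t := y + α + 1)
    (a := α) (b := 1 - α) (by positivity) (by positivity) h0 (by linarith) (by ring)
  have e : α * (y + α) + (1 - α) * (y + α + 1) = y + 1 := by ring
  have hya : 0 < y + α := by positivity
  have hG := Real.Gamma_pos_of_pos hya
  rw [e, Real.Gamma_add_one hy.ne', Real.Gamma_add_one hya.ne',
    Real.mul_rpow hya.le hG.le] at h
  refine h.trans_eq ?_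
  calc _ = (Real.Gamma (y + α) ^ α * Real.Gamma (y + α) ^ (1 - α)) * (y + α) ^ (1 - α) := by ring
    _ = _ := by rw [← Real.rpow_add hG]; simp

theorem summable_pow_div_Gamma {α : ℝ} (h0 : 0 < α) (h1 : α < 1) (x : ℝ) :
    Summable fun k : ℕ => x ^ k / Real.Gamma (α * k + 1) := by
  have hlim : Filter.Tendsto (fun k : ℕ => 2 * |x| * (α * (k : ℝ) + 1) ^ (-α))
      Filter.atTop (nhds 0) := by
    have h2 : Filter.Tendsto (fun k : ℕ => α * (k : ℝ) + 1) Filter.atTop Filter.atTop :=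
      Filter.tendsto_atTop_add_const_right _ _
        (tendsto_natCast_atTop_atTop.const_mul_atTop h0)
    simpa using ((tendsto_rpow_neg_atTop h0).comp h2).const_mul (2 * |x|)
  refine summable_of_ratio_norm_eventually_le (r := 1 / 2) (by norm_num) ?_
  filter_upwards [hlim.eventually_le_const (by norm_num : (0 : ℝ) < 1 / 2)] with k hk
  set y : ℝ := α * k + 1 with hy
  have hy1 : 1 ≤ y := by rw [hy]; have : 0 ≤ α * k := by positivity
                         linarith
  have hy0 : 0 < y := by linarith
  have e : α * ((k + 1 : ℕ) : ℝ) + 1 = y + α := by push_cast; ring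
  have hG := Real.Gamma_pos_of_pos hy0
  have hG' := Real.Gamma_pos_of_pos (add_pos hy0 h0)
  have hkey : Real.Gamma y ≤ Real.Gamma (y + α) * (2 * y ^ (-α)) := by
    have h3 := Gamma_le_Gamma_add_mul hy0 h0 h1
    have h4 : (y + α) ^ (1 - α) ≤ 2 * (y * y ^ (-α)) := by
      calc (y + α) ^ (1 - α) ≤ (2 * y) ^ (1 - α) :=
            Real.rpow_le_rpow (by positivity) (by linarith) (by linarith)
        _ = 2 ^ (1 - α) * y ^ (1 - α) := Real.mul_rpow (by norm_num) hy0.le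
        _ ≤ 2 ^ (1 : ℝ) * y ^ (1 - α) := by
            gcongr
            · norm_num
            · linarith
        _ = 2 * (y * y ^ (-α)) := by
            rw [Real.rpow_one, sub_eq_add_neg, Real.rpow_add hy0, Real.rpow_one]
    have h5 : y * Real.Gamma y ≤ y * (Real.Gamma (y + α) * (2 * y ^ (-α))) := by
      calc _ ≤ _ := h3
        _ ≤ Real.Gamma (y + α) * (2 * (y * y ^ (-α))) := by gcongr
        _ = _ := by ring
    exact le_of_mul_le_mul_left h5 hy0
  rw [e, norm_div, norm_div, norm_pow, norm_pow, Real.norm_of_nonneg hG.le,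
    Real.norm_of_nonneg hG'.le, Real.norm_eq_abs, pow_succ, div_le_iff₀ hG']
  have h6 : 1 ≤ Real.Gamma (y + α) * (2 * y ^ (-α)) / Real.Gamma y := by
    rwa [le_div_iff₀ hG, one_mul]
  calc |x| ^ k * |x| ≤ |x| ^ k * |x| * (Real.Gamma (y + α) * (2 * y ^ (-α)) / Real.Gamma y) :=
        le_mul_of_one_le_right (by positivity) h6
    _ = (|x| ^ k / Real.Gamma y * Real.Gamma (y + α)) * (2 * |x| * y ^ (-α)) := by ring
    _ ≤ (|x| ^ k / Real.Gamma y * Real.Gamma (y + α)) * (1 / 2) := by gcongr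
    _ = _ := by ring

/-- Coefficients of the `j`-fold Euler derivative of the Mittag-Leffler function `E_α(-x)`. -/
noncomputable def mlCoeff (α : ℝ) (j k : ℕ) : ℝ :=
  (-1) ^ k * (α * k) ^ j / Real.Gamma (α * k + 1)

/-- The function with `ml α j (t ^ α) = (t d/dt)^j E_α(-t ^ α)`. -/
noncomputable def ml (α : ℝ) (j : ℕ) (x : ℝ) : ℝ := ∑' k, mlCoeff α j k * x ^ k

theorem summable_mlCoeff {α : ℝ} (h0 : 0 < α) (h1 : α < 1) (j : ℕ) (x : ℝ) :
    Summable fun k => |mlCoeff α j k| * |x| ^ k := by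
  have h := (summable_pow_div_Gamma h0 h1 (Real.exp 1 * |x|)).mul_left (Nat.factorial j : ℝ)
  refine Summable.of_nonneg_of_le (fun k => by positivity) (fun k => ?_) h
  have hG : 0 < Real.Gamma (α * k + 1) := Real.Gamma_pos_of_pos (by positivity)
  have h2 : (α * k) ^ j ≤ Nat.factorial j * Real.exp 1 ^ k := by
    have h3 := Real.pow_div_factorial_le_exp (α * k) (by positivity) j
    rw [div_le_iff₀ (by positivity)] at h3
    have h4 : Real.exp (α * k) ≤ Real.exp 1 ^ k := by
      rw [← Real.exp_nat_mul, mul_one]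
      refine Real.exp_le_exp.2 ?_
      have : (0 : ℝ) ≤ k := by positivity
      nlinarith
    calc _ ≤ _ := h3
      _ ≤ Real.exp 1 ^ k * Nat.factorial j := by gcongr
      _ = _ := mul_comm _ _
  have h5 : |mlCoeff α j k| = (α * k) ^ j / Real.Gamma (α * k + 1) := by
    rw [mlCoeff, abs_div, abs_mul, abs_pow, abs_neg, abs_one, one_pow, one_mul,
      abs_of_pos hG, abs_of_nonneg (by positivity)]
  rw [h5, mul_pow (Real.exp 1)]
  calc _ ≤ Nat.factorial j * Real.exp 1 ^ k / Real.Gamma (α * k + 1) * |x| ^ k :=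
        mul_le_mul_of_nonneg_right (div_le_div_of_nonneg_right h2 hG.le) (by positivity)
    _ = _ := by ring

theorem summable_mlCoeff_mul_pow {α : ℝ} (h0 : 0 < α) (h1 : α < 1) (j : ℕ) (x : ℝ) :
    Summable fun k => mlCoeff α j k * x ^ k := by
  refine Summable.of_norm ?_
  simpa [norm_mul, norm_pow] using summable_mlCoeff h0 h1 j x

theorem mlCoeff_succ (α : ℝ) (j k : ℕ) : mlCoeff α (j + 1) k = α * k * mlCoeff α j k := by
  rw [mlCoeff, mlCoeff]; ring

theorem hasDerivAt_ml {α : ℝ} (h0 : 0 < α) (h1 : α < 1) (j : ℕ) {x : ℝ} (hx : x ≠ 0) :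
    HasDerivAt (ml α j) (ml α (j + 1) x / (α * x)) x := by
  set R := |x| + 1 with hR
  have hR1 : 1 ≤ R := by rw [hR]; linarith [abs_nonneg x]
  have hu := (summable_mlCoeff h0 h1 (j + 1) R).mul_left (1 / α)
  have h := hasDerivAt_tsum_of_isPreconnected (𝕜 := ℝ) (F := ℝ)
    (g := fun k y => mlCoeff α j k * y ^ k)
    (g' := fun k y => mlCoeff α j k * (k * y ^ (k - 1))) (t := Metric.ball 0 R) (y₀ := x) (y := x)
    hu Metric.isOpen_ball (convex_ball _ _).isPreconnected
    (fun k y _ => (hasDerivAt_pow k y).const_mul _) (fun k y hy => ?_) (by simp [hR])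
    (summable_mlCoeff_mul_pow h0 h1 j x) (by simp [hR])
  · convert! h using 1
    rw [ml, ← tsum_div_const]
    refine tsum_congr fun k => ?_
    rw [mlCoeff_succ]
    rcases k with _ | k
    · simp
    · rw [Nat.add_sub_cancel, pow_succ]
      field_simp
  · rw [mem_ball_zero_iff, Real.norm_eq_abs] at hy
    rw [norm_mul, norm_mul, norm_pow, mlCoeff_succ, abs_mul, abs_mul, abs_of_pos h0]
    simp only [Real.norm_eq_abs, Nat.abs_cast]
    have : |y| ^ (k - 1) ≤ |R| ^ k := by
      calc |y| ^ (k - 1) ≤ |R| ^ (k - 1) :=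
            pow_le_pow_left₀ (abs_nonneg y) (hy.le.trans (le_abs_self _)) _
        _ ≤ |R| ^ k := pow_le_pow_right₀ (hR1.trans (le_abs_self _)) (by omega)
    calc _ ≤ |mlCoeff α j k| * (k * |R| ^ k) := by gcongr
      _ = _ := by field_simp

theorem continuous_ml {α : ℝ} (h0 : 0 < α) (h1 : α < 1) (j : ℕ) : Continuous (ml α j) := by
  rw [continuous_iff_continuousAt]
  intro x
  have h : ContinuousOn (ml α j) (Metric.closedBall 0 (|x| + 1)) := by
    refine continuousOn_tsum (fun k => by fun_prop) (summable_mlCoeff h0 h1 j (|x| + 1))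
      fun k y hy => ?_
    rw [mem_closedBall_zero_iff, Real.norm_eq_abs] at hy
    rw [norm_mul, norm_pow, Real.norm_eq_abs, Real.norm_eq_abs]
    exact mul_le_mul_of_nonneg_left
      (pow_le_pow_left₀ (abs_nonneg y) (hy.trans (le_abs_self _)) _) (abs_nonneg _)
  exact h.continuousAt (Metric.closedBall_mem_nhds_of_mem (by simp))

theorem mlCoeff_zero_zero (α : ℝ) : mlCoeff α 0 0 = 1 := by simp [mlCoeff]

theorem mlCoeff_succ_zero (α : ℝ) (j : ℕ) : mlCoeff α (j + 1) 0 = 0 := by simp [mlCoeff]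

theorem exists_abs_ml_sub_le {α : ℝ} (h0 : 0 < α) (h1 : α < 1) (j : ℕ) {X : ℝ} (hX : 1 ≤ X) :
    ∃ C, 0 ≤ C ∧ ∀ x, 0 ≤ x → x ≤ X → |ml α j x - mlCoeff α j 0| ≤ C * x := by
  have hs := (summable_nat_add_iff 1).2 (summable_mlCoeff h0 h1 j X)
  refine ⟨∑' k, |mlCoeff α j (k + 1)| * |X| ^ (k + 1), tsum_nonneg fun k => by positivity,
    fun x hx hxX => ?_⟩
  rw [ml, (summable_mlCoeff_mul_pow h0 h1 j x).tsum_eq_zero_add, pow_zero, mul_one,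
    add_sub_cancel_left, ← tsum_mul_right, ← Real.norm_eq_abs]
  refine tsum_of_norm_bounded (hs.mul_right x).hasSum fun k => ?_
  rw [norm_mul, norm_pow, Real.norm_eq_abs, Real.norm_of_nonneg hx, mul_assoc]
  gcongr
  rw [pow_succ]
  gcongr
  rw [abs_of_nonneg (by linarith)]
  calc x ^ k ≤ X ^ k := by gcongr
    _ ≤ X ^ (k + 1) := pow_le_pow_right₀ hX (by omega)

theorem hasDerivAt_ml_rpow {α l t : ℝ} (h0 : 0 < α) (h1 : α < 1) (hl : 0 < l) (ht : 0 < t)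
    (j : ℕ) :
    HasDerivAt (fun s => ml α j (l * s ^ α)) (ml α (j + 1) (l * t ^ α) / t) t := by
  have hx : 0 < l * t ^ α := by positivity
  have h := (hasDerivAt_ml h0 h1 j hx.ne').comp t
    ((Real.hasDerivAt_rpow_const (p := α) (Or.inl ht.ne')).const_mul l)
  convert! h using 1
  have hp : t ^ (α - 1) = t ^ α / t := Real.rpow_sub_one ht.ne' α
  have : 0 < t ^ α := by positivity
  rw [hp]
  field_simp

theorem continuous_ml_rpow {α : ℝ} (h0 : 0 < α) (h1 : α < 1) (l : ℝ) (j : ℕ) :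
    Continuous fun s => ml α j (l * s ^ α) :=
  (continuous_ml h0 h1 j).comp (continuous_const.mul (Real.continuous_rpow_const h0.le))

theorem integrableOn_ml {α l t : ℝ} (h0 : 0 < α) (h1 : α < 1) (hl : 0 < l) (ht : 0 < t)
    (j : ℕ) :
    MeasureTheory.IntegrableOn
      (fun s => (t - s) ^ (-α) * (ml α (j + 1) (l * s ^ α) / s)) (Set.Ioo 0 t) := by
  obtain ⟨C, hC0, hC⟩ := exists_abs_ml_sub_le h0 h1 (j + 1) (X := l * t ^ α + 1)
    (by have : 0 < l * t ^ α := by positivity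
        linarith)
  have hb := ((integral_Ioo_rpow_mul_rpow (sub_pos.2 h1) h0 ht).1).const_mul (C * l)
  refine MeasureTheory.Integrable.mono' hb ?_ ?_
  · refine ContinuousOn.aestronglyMeasurable ?_ measurableSet_Ioo
    refine ContinuousOn.mul ?_ ?_
    · refine ContinuousOn.rpow_const (by fun_prop) fun s hs => Or.inl (sub_pos.2 hs.2).ne'
    · exact (continuous_ml_rpow h0 h1 l _).continuousOn.div continuousOn_id
        fun s hs => hs.1.ne'
  · refine (MeasureTheory.ae_restrict_iff' measurableSet_Ioo).2 (.of_forall fun s hs => ?_)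
    have hs0 := hs.1
    have hts : 0 < t - s := sub_pos.2 hs.2
    have h2 := hC (l * s ^ α) (by positivity) (by
      have : s ^ α ≤ t ^ α := Real.rpow_le_rpow hs0.le hs.2.le h0.le
      nlinarith)
    rw [mlCoeff_succ_zero, sub_zero] at h2
    rw [norm_mul, norm_div, Real.norm_eq_abs, Real.norm_eq_abs, Real.norm_eq_abs,
      abs_of_pos hs0, abs_of_pos (Real.rpow_pos_of_pos hts _)]
    have e : 1 - α - 1 = -α := by ring
    rw [e, Real.rpow_sub_one hs0.ne']
    have hp : 0 < (t - s) ^ (-α) := Real.rpow_pos_of_pos hts _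
    calc _ ≤ (t - s) ^ (-α) * (C * (l * s ^ α) / s) := by gcongr
      _ = _ := by ring

/-- Termwise evaluation of the Caputo derivative of `t ↦ ml α j (l * t ^ α)`. -/
theorem integral_ml_of_hasSum {α l t S : ℝ} (h0 : 0 < α) (h1 : α < 1) (ht : 0 < t) (j : ℕ)
    (hS : HasSum (fun k : ℕ => (-1) ^ k * (α * k + α) ^ j / Real.Gamma (α * k + 1)
      * (l * t ^ α) ^ k) S) :
    ∫ s in Set.Ioo 0 t, (t - s) ^ (-α) * (ml α (j + 1) (l * s ^ α) / s)
      = -(Real.Gamma (1 - α) * l * S) := by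
  set F : ℕ → ℝ → ℝ := fun k s =>
    (t - s) ^ (-α) * (mlCoeff α (j + 1) (k + 1) * (l * s ^ α) ^ (k + 1) / s) with hF
  set m : ℕ → ℝ := fun k => mlCoeff α (j + 1) (k + 1) * l ^ (k + 1) with hm
  have hFe : ∀ k, Set.EqOn (F k)
      (fun s => m k * ((t - s) ^ (1 - α - 1) * s ^ (α * (k + 1) - 1))) (Set.Ioo 0 t) := by
    intro k s hs
    simp only [hF, hm]
    rw [Real.rpow_sub_one hs.1.ne' (α * (k + 1)), Real.rpow_mul hs.1.le, mul_pow]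
    have e : 1 - α - 1 = -α := by ring
    have e2 : (s ^ α) ^ ((k : ℝ) + 1) = (s ^ α) ^ (k + 1) := by
      rw [← Real.rpow_natCast]; push_cast; rfl
    rw [e, e2]
    ring
  have hbeta : ∀ k : ℕ, _ := fun k =>
    integral_Ioo_rpow_mul_rpow (sub_pos.2 h1) (b := α * (k + 1)) (by positivity) ht
  have hint : ∀ k, MeasureTheory.IntegrableOn (F k) (Set.Ioo 0 t) := fun k =>
    MeasureTheory.IntegrableOn.congr_fun (((hbeta k).1).const_mul (m k))
      (fun s hs => (hFe k hs).symm) measurableSet_Ioo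
  set T : ℕ → ℝ := fun k => (-1) ^ k * (α * k + α) ^ j / Real.Gamma (α * k + 1)
      * (l * t ^ α) ^ k with hT
  have hkey : ∀ k : ℕ, m k * (t ^ (1 - α + α * (k + 1) - 1) *
      (Real.Gamma (1 - α) * Real.Gamma (α * (k + 1)) / Real.Gamma (1 - α + α * (k + 1))))
      = -(Real.Gamma (1 - α) * l * T k) := by
    intro k
    have e1 : 1 - α + α * (k + 1) = α * k + 1 := by ring
    have hpos : 0 < α * ((k : ℝ) + 1) := by positivity
    have hG := (Real.Gamma_pos_of_pos hpos).ne'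
    have hG2 : Real.Gamma (α * k + 1) ≠ 0 := (Real.Gamma_pos_of_pos (by positivity)).ne'
    simp only [hm, hT, mlCoeff]
    push_cast
    rw [e1, Real.Gamma_add_one hpos.ne', add_sub_cancel_right, Real.rpow_mul ht.le,
      Real.rpow_natCast, mul_pow l]
    have e3 : α * (k : ℝ) + α = α * (k + 1) := by ring
    rw [e3]
    generalize α * ((k : ℝ) + 1) = y at *
    field_simp
    ring
  have hval : ∀ k, ∫ s in Set.Ioo 0 t, F k s = -(Real.Gamma (1 - α) * l * T k) := by
    intro k
    rw [MeasureTheory.setIntegral_congr_fun measurableSet_Ioo (hFe k),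
      MeasureTheory.integral_const_mul, (hbeta k).2, hkey]
  have hnorm : ∀ k, ∫ s in Set.Ioo 0 t, ‖F k s‖ = |-(Real.Gamma (1 - α) * l * T k)| := by
    intro k
    have : Set.EqOn (fun s => ‖F k s‖)
      (fun s => |m k| * ((t - s) ^ (1 - α - 1) * s ^ (α * (k + 1) - 1))) (Set.Ioo 0 t) := by
      intro s hs
      have hs0 := hs.1
      have hts : 0 < t - s := sub_pos.2 hs.2
      simp only [hFe k hs, norm_mul, Real.norm_eq_abs]
      rw [abs_of_pos (Real.rpow_pos_of_pos hts _), abs_of_pos (Real.rpow_pos_of_pos hs0 _)]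
    rw [MeasureTheory.setIntegral_congr_fun measurableSet_Ioo this,
      MeasureTheory.integral_const_mul, (hbeta k).2, ← hkey]
    have a1 := Real.Gamma_pos_of_pos (sub_pos.2 h1)
    have a2 : 0 < Real.Gamma (α * (k + 1)) := Real.Gamma_pos_of_pos (by positivity)
    have a3 : 0 < Real.Gamma (1 - α + α * (k + 1)) :=
      Real.Gamma_pos_of_pos (add_pos (sub_pos.2 h1) (by positivity))
    have a4 : 0 < t ^ (1 - α + α * (k + 1) - 1) *
        (Real.Gamma (1 - α) * Real.Gamma (α * (k + 1)) / Real.Gamma (1 - α + α * (k + 1))) :=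
      mul_pos (Real.rpow_pos_of_pos ht _) (div_pos (mul_pos a1 a2) a3)
    rw [abs_mul (m k), abs_of_pos a4]
  have hsum := MeasureTheory.hasSum_integral_of_summable_integral_norm hint (by
    simp_rw [hnorm]
    exact ((hS.summable.mul_left _).neg).abs)
  have hsum2 : HasSum (fun k => ∫ s in Set.Ioo 0 t, F k s) (-(Real.Gamma (1 - α) * l * S)) := by
    simp_rw [hval]
    exact (hS.mul_left _).neg
  rw [← hsum.unique hsum2]
  refine MeasureTheory.setIntegral_congr_fun measurableSet_Ioo fun s hs => ?_
  simp only [hF]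
  rw [tsum_mul_left, tsum_div_const, ml, (summable_mlCoeff_mul_pow h0 h1 (j + 1) _).tsum_eq_zero_add,
    mlCoeff_succ_zero, zero_mul, zero_add]

/-- If `p` attains its maximum over `[0, t]` at `t`, its Caputo derivative at `t` is bounded below. -/
theorem rpow_mul_sub_le_integral_of_forall_le {α t : ℝ} (h0 : 0 < α) (h1 : α < 1) (ht : 0 < t)
    {p p' : ℝ → ℝ} (hc : ContinuousOn p (Set.Icc 0 t))
    (hd : ∀ s, 0 < s → s ≤ t → HasDerivAt p (p' s) s) (hmax : ∀ s ∈ Set.Icc 0 t, p s ≤ p t)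
    (hi : MeasureTheory.IntegrableOn (fun s => (t - s) ^ (-α) * p' s) (Set.Ioo 0 t)) :
    t ^ (-α) * (p t - p 0) ≤ ∫ s in Set.Ioo 0 t, (t - s) ^ (-α) * p' s := by
  set q : ℝ → ℝ := fun s => (t - s) ^ (-α) * (p s - p t) with hq
  have hqc : ContinuousOn q (Set.Icc 0 t) := by
    intro s hs
    rcases hs.2.eq_or_lt with rfl | hst
    · have hO := (hd s ht le_rfl).isBigO_sub
      have h2 : (fun x => x - s) =O[nhds s] fun x => |s - x| := by
        refine Asymptotics.IsBigO.of_bound 1 (.of_forall fun x => ?_)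
        rw [one_mul, Real.norm_eq_abs, Real.norm_eq_abs, abs_abs, abs_sub_comm]
      obtain ⟨K, hK⟩ := (hO.trans h2).bound
      have hqs : q s = 0 := by simp [hq]
      rw [ContinuousWithinAt, hqs]
      have hlim : Filter.Tendsto (fun x => K * |s - x| ^ (1 - α))
          (nhdsWithin s (Set.Icc 0 s)) (nhds 0) := by
        have hcont : Continuous fun x => K * |s - x| ^ (1 - α) :=
          continuous_const.mul ((continuous_abs.comp (continuous_const.sub continuous_id)).rpow_const
            fun x => Or.inr (by linarith))
        have := (hcont.tendsto s).mono_left (nhdsWithin_le_nhds (s := Set.Icc 0 s))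
        simpa [Real.zero_rpow (sub_pos.2 h1).ne'] using this
      refine squeeze_zero_norm' ?_ hlim
      filter_upwards [nhdsWithin_le_nhds hK, self_mem_nhdsWithin] with x hx hxs
      rcases hxs.2.eq_or_lt with rfl | hlt
      · simp [hq, Real.zero_rpow (sub_pos.2 h1).ne']
      · have hpos : 0 < s - x := sub_pos.2 hlt
        rw [Real.norm_of_nonneg (abs_nonneg _), abs_of_pos hpos] at hx
        simp only [hq]
        rw [norm_mul, Real.norm_of_nonneg (Real.rpow_nonneg hpos.le _), abs_of_pos hpos]
        have e : (s - x) ^ (1 - α) = (s - x) ^ (-α) * (s - x) := by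
          rw [← Real.rpow_add_one hpos.ne']; ring_nf
        calc _ ≤ (s - x) ^ (-α) * (K * (s - x)) := by gcongr
          _ = _ := by rw [e]; ring
    · refine ContinuousWithinAt.mul ?_ ((hc s hs).sub continuousWithinAt_const)
      exact ContinuousWithinAt.rpow_const (by fun_prop) (Or.inl (sub_pos.2 hst).ne')
  have hi' : MeasureTheory.IntegrableOn (fun s => (t - s) ^ (-α) * p' s) (Set.Icc 0 t) :=
    (integrableOn_Icc_iff_integrableOn_Ioo enorm_ne_top enorm_ne_top).2 hi
  have h := intervalIntegral.sub_le_integral_of_hasDeriv_right_of_le (g := q)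
    (g' := fun s => (-1) * -α * (t - s) ^ (-α - 1) * (p s - p t) + (t - s) ^ (-α) * p' s)
    ht.le hqc (fun s hs => ?_) hi' (fun s hs => ?_)
  · rw [intervalIntegral.integral_of_le ht.le, MeasureTheory.integral_Ioc_eq_integral_Ioo] at h
    refine le_trans (le_of_eq ?_) h
    simp [hq]
    ring
  · have hd1 : HasDerivAt (fun s => (t - s) ^ (-α)) ((-1) * -α * (t - s) ^ (-α - 1)) s :=
      ((hasDerivAt_id s).const_sub t).rpow_const (Or.inl (sub_pos.2 hs.2).ne')
    exact (hd1.mul ((hd s hs.1 hs.2.le).sub_const (p t))).hasDerivWithinAt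
  · have h3 : p s - p t ≤ 0 := sub_nonpos.2 (hmax s ⟨hs.1.le, hs.2.le⟩)
    have h4 : 0 ≤ (t - s) ^ (-α - 1) := Real.rpow_nonneg (sub_nonneg.2 hs.2.le) _
    have h5 : (-1) * -α * (t - s) ^ (-α - 1) * (p s - p t) ≤ 0 :=
      mul_nonpos_of_nonneg_of_nonpos (by rw [neg_mul_neg, one_mul]; positivity) h3
    linarith

/-- Maximum principle for the fractional differential inequality. -/
theorem le_of_integral_le {α : ℝ} (h0 : 0 < α) (h1 : α < 1) {p p' : ℝ → ℝ} {c : ℝ}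
    (hc : ContinuousOn p (Set.Ici 0)) (hd : ∀ s, 0 < s → HasDerivAt p (p' s) s)
    (hi : ∀ t, 0 < t →
      MeasureTheory.IntegrableOn (fun s => (t - s) ^ (-α) * p' s) (Set.Ioo 0 t))
    (hp0 : p 0 ≤ c)
    (hle : ∀ t, 0 < t → ∃ r, 0 < r ∧
      ∫ s in Set.Ioo 0 t, (t - s) ^ (-α) * p' s ≤ r * (c - p t))
    {t : ℝ} (ht : 0 ≤ t) : p t ≤ c := by
  by_contra! hlt
  obtain ⟨x, hx, hmax⟩ := isCompact_Icc.exists_isMaxOn (Set.nonempty_Icc.2 ht)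
    (hc.mono Set.Icc_subset_Ici_self)
  have hpx : c < p x := hlt.trans_le (hmax (Set.right_mem_Icc.2 ht))
  have hx0 : 0 < x := by
    refine hx.1.lt_of_ne fun h => ?_
    rw [← h] at hpx
    linarith
  have h2 := rpow_mul_sub_le_integral_of_forall_le h0 h1 hx0 (p := p)
    (hc.mono Set.Icc_subset_Ici_self) (fun s hs _ => hd s hs)
    (fun s hs => hmax ⟨hs.1, hs.2.trans hx.2⟩) (hi x hx0)
  obtain ⟨r, hr, h3⟩ := hle x hx0
  have h4 : 0 ≤ x ^ (-α) * (p x - p 0) := mul_nonneg (by positivity) (by linarith)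
  have h5 : r * (c - p x) < 0 := mul_neg_of_pos_of_neg hr (by linarith)
  linarith

theorem integral_ml {α l t : ℝ} (h0 : 0 < α) (h1 : α < 1) (ht : 0 < t) (j : ℕ) :
    ∫ s in Set.Ioo 0 t, (t - s) ^ (-α) * (ml α (j + 1) (l * s ^ α) / s)
      = -(Real.Gamma (1 - α) * l * ∑ i ∈ Finset.range (j + 1),
          ml α i (l * t ^ α) * (α ^ (j - i) * j.choose i)) := by
  refine integral_ml_of_hasSum h0 h1 ht j ?_
  have h := hasSum_sum (s := Finset.range (j + 1)) fun i _ =>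
    ((summable_mlCoeff_mul_pow h0 h1 i (l * t ^ α)).hasSum).mul_right (α ^ (j - i) * j.choose i)
  refine h.congr_fun fun k => ?_
  rw [add_pow, Finset.mul_sum, Finset.sum_div, Finset.sum_mul]
  refine Finset.sum_congr rfl fun i _ => ?_
  rw [mlCoeff]
  ring

theorem ml_zero {α : ℝ} (h0 : 0 < α) (h1 : α < 1) (j : ℕ) : ml α j 0 = mlCoeff α j 0 := by
  obtain ⟨C, _, h⟩ := exists_abs_ml_sub_le h0 h1 j le_rfl
  have := h 0 le_rfl zero_le_one
  rw [mul_zero] at this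
  exact sub_eq_zero.1 (abs_nonpos_iff.1 this)

theorem ml_le_of_forall {α : ℝ} (h0 : 0 < α) (h1 : α < 1) (j : ℕ) {c : ℝ} (σ : ℝ)
    (hc0 : σ * mlCoeff α j 0 ≤ c)
    (hc : ∀ x, 0 < x → -(σ * ∑ i ∈ Finset.range j, ml α i x * (α ^ (j - i) * j.choose i)) ≤ c)
    {x : ℝ} (hx : 0 ≤ x) : σ * ml α j x ≤ c := by
  have h := le_of_integral_le h0 h1 (p := fun s => σ * ml α j (1 * s ^ α))
    (p' := fun s => σ * (ml α (j + 1) (1 * s ^ α) / s)) (c := c)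
    ((continuous_ml_rpow h0 h1 1 j).continuousOn.const_smul σ)
    (fun s hs => (hasDerivAt_ml_rpow h0 h1 one_pos hs j).const_mul σ)
    (fun t ht => ?_) ?_ (fun t ht => ⟨Real.Gamma (1 - α), Real.Gamma_pos_of_pos (sub_pos.2 h1), ?_⟩)
    (Real.rpow_nonneg hx (1 / α))
  · simpa [← Real.rpow_mul hx, h0.ne'] using h
  · refine ((integrableOn_ml h0 h1 one_pos ht j).const_mul σ).congr (.of_forall fun s => ?_)
    ring
  · simpa [Real.zero_rpow h0.ne', ml_zero h0 h1] using hc0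
  · have e : ∀ s, (t - s) ^ (-α) * (σ * (ml α (j + 1) (1 * s ^ α) / s))
        = σ * ((t - s) ^ (-α) * (ml α (j + 1) (1 * s ^ α) / s)) := fun s => by ring
    simp_rw [e]
    rw [MeasureTheory.integral_const_mul, integral_ml h0 h1 ht, Finset.sum_range_succ]
    have h2 := hc (1 * t ^ α) (by positivity)
    have h3 := Real.Gamma_pos_of_pos (sub_pos.2 h1)
    simp only [Nat.sub_self, pow_zero, Nat.choose_self, Nat.cast_one, mul_one]
    nlinarith

theorem ml_zero_nonneg {α : ℝ} (h0 : 0 < α) (h1 : α < 1) {x : ℝ} (hx : 0 ≤ x) :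
    0 ≤ ml α 0 x := by
  simpa using ml_le_of_forall h0 h1 0 (c := 0) (-1) (by simp [mlCoeff]) (by simp) hx

theorem ml_one_nonpos {α : ℝ} (h0 : 0 < α) (h1 : α < 1) {x : ℝ} (hx : 0 ≤ x) :
    ml α 1 x ≤ 0 := by
  simpa using ml_le_of_forall h0 h1 1 (c := 0) 1 (by simp [mlCoeff])
    (fun y hy => by simpa using mul_nonneg (ml_zero_nonneg h0 h1 hy.le) h0.le) hx

theorem exists_abs_ml_le {α : ℝ} (h0 : 0 < α) (h1 : α < 1) (j : ℕ) :
    ∃ M, 0 ≤ M ∧ ∀ x, 0 ≤ x → |ml α j x| ≤ M := by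
  induction j using Nat.strong_induction_on with
  | _ j ih =>
    choose! M hM0 hM using ih
    set D := ∑ i ∈ Finset.range j, M i * (α ^ (j - i) * j.choose i) with hD
    have hb : ∀ x, 0 < x →
        |∑ i ∈ Finset.range j, ml α i x * (α ^ (j - i) * j.choose i)| ≤ D := fun x hx => by
      refine (Finset.abs_sum_le_sum_abs _ _).trans (Finset.sum_le_sum fun i hi => ?_)
      have h2 : 0 ≤ α ^ (j - i) * (j.choose i : ℝ) := by positivity
      rw [abs_mul, abs_of_nonneg h2]
      exact mul_le_mul_of_nonneg_right (hM i (Finset.mem_range.1 hi) x hx.le) h2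
    refine ⟨max D |mlCoeff α j 0|, (abs_nonneg _).trans (le_max_right _ _), fun x hx => ?_⟩
    set E := max D |mlCoeff α j 0| with hE
    have hDE : D ≤ E := le_max_left _ _
    have hcE : |mlCoeff α j 0| ≤ E := le_max_right _ _
    have hA := ml_le_of_forall h0 h1 j (c := E) 1
      (by rw [one_mul]; exact (le_abs_self _).trans hcE)
      (fun y hy => by rw [one_mul]; exact (neg_le_abs _).trans ((hb y hy).trans hDE)) hx
    have hB := ml_le_of_forall h0 h1 j (c := E) (-1)
      (by rw [neg_one_mul]; exact (neg_le_abs _).trans hcE)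
      (fun y hy => by
        rw [neg_one_mul, neg_neg]; exact (le_abs_self _).trans ((hb y hy).trans hDE)) hx
    exact abs_le.2 ⟨by linarith, by linarith⟩

theorem exists_abs_ml_sub_le_min {α : ℝ} (h0 : 0 < α) (h1 : α < 1) (j : ℕ) :
    ∃ M, 0 ≤ M ∧ ∀ x, 0 ≤ x → |ml α j x - mlCoeff α j 0| ≤ M * min 1 x := by
  obtain ⟨M, hM0, hM⟩ := exists_abs_ml_le h0 h1 j
  obtain ⟨C, hC0, hC⟩ := exists_abs_ml_sub_le h0 h1 j le_rfl
  refine ⟨M + |mlCoeff α j 0| + C, by positivity, fun x hx => ?_⟩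
  have ha := abs_nonneg (mlCoeff α j 0)
  rcases le_total x 1 with h | h
  · rw [min_eq_right h]
    refine (hC x hx h).trans ?_
    gcongr
    linarith
  · rw [min_eq_left h, mul_one]
    calc _ ≤ |ml α j x| + |mlCoeff α j 0| := abs_sub _ _
      _ ≤ _ := by linarith [hM x hx]

/-- Partial sums of the convolution quadrature weights. -/
noncomputable def cqCumWeight (α : ℝ) (j : ℕ) : ℝ := ∑ i ∈ Finset.range (j + 1), cqWeight α i

theorem cqCumWeight_zero (α : ℝ) : cqCumWeight α 0 = 1 := by simp [cqCumWeight, cqWeight]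

theorem cqCumWeight_succ_eq_add (α : ℝ) (j : ℕ) :
    cqCumWeight α (j + 1) = cqCumWeight α j + cqWeight α (j + 1) := by
  rw [cqCumWeight, Finset.sum_range_succ, cqCumWeight]

theorem cqWeight_succ (α : ℝ) (j : ℕ) :
    cqWeight α (j + 1) = -(α / (j + 1) * cqCumWeight α j) := by
  induction j with
  | zero => simp [cqCumWeight, cqWeight]
  | succ j ih =>
    have h : cqWeight α (j + 1 + 1) = cqWeight α (j + 1) * ((j + 1 - α) / (j + 2)) := by
      rw [cqWeight, cqWeight, Finset.prod_range_succ _ (j + 1), Nat.factorial_succ (j + 1), pow_succ]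
      push_cast
      field_simp
      ring
    rw [h, cqCumWeight_succ_eq_add, ih]
    push_cast
    field_simp
    ring

theorem cqCumWeight_succ (α : ℝ) (j : ℕ) :
    cqCumWeight α (j + 1) = cqCumWeight α j * ((j + 1 - α) / (j + 1)) := by
  rw [cqCumWeight_succ_eq_add, cqWeight_succ]
  field_simp
  ring

theorem cqCumWeight_eq_Gamma {α : ℝ} (h1 : α < 1) (j : ℕ) :
    cqCumWeight α j
      = 1 / Real.Gamma (1 - α) * (Real.Gamma (j + 1 - α) / Real.Gamma (j + 1)) := by
  induction j with
  | zero =>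
    have := Real.Gamma_pos_of_pos (sub_pos.2 h1)
    simp only [cqCumWeight_zero, Nat.cast_zero, zero_add, Real.Gamma_one]
    field_simp
  | succ j ih =>
    have hj : (0 : ℝ) ≤ j := j.cast_nonneg
    have e : ((j + 1 : ℕ) : ℝ) + 1 - α = (j + 1 - α) + 1 := by push_cast; ring
    have e2 : ((j + 1 : ℕ) : ℝ) + 1 = (j + 1 : ℝ) + 1 := by push_cast; ring
    rw [cqCumWeight_succ, ih, e, e2, Real.Gamma_add_one (by linarith : (0 : ℝ) < j + 1 - α).ne',
      Real.Gamma_add_one (show (0 : ℝ) < (j : ℝ) + 1 by positivity).ne']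
    have := Real.Gamma_pos_of_pos (show (0 : ℝ) < j + 1 by positivity)
    have := Real.Gamma_pos_of_pos (sub_pos.2 h1)
    field_simp

theorem sum_cqCumWeight {α : ℝ} (h1 : α < 1) (j : ℕ) :
    ∑ i ∈ Finset.range j, cqCumWeight α i = j * cqCumWeight α j / (1 - α) := by
  have h2 : 1 - α ≠ 0 := (sub_pos.2 h1).ne'
  induction j with
  | zero => simp
  | succ j ih =>
    rw [Finset.sum_range_succ, ih, cqCumWeight_succ]
    push_cast
    field_simp
    ring

theorem le_cqCumWeight {α : ℝ} (h0 : 0 < α) (h1 : α < 1) (j : ℕ) :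
    1 / Real.Gamma (1 - α) * (j + 1 : ℝ) ^ (-α) ≤ cqCumWeight α j := by
  have hG1 := Real.Gamma_pos_of_pos (sub_pos.2 h1)
  have hj : (0 : ℝ) ≤ j := j.cast_nonneg
  have hy : (0 : ℝ) < j + 1 - α := by linarith
  have hG := Real.Gamma_pos_of_pos hy
  have hG2 := Real.Gamma_pos_of_pos (show (0 : ℝ) < j + 1 by positivity)
  rw [cqCumWeight_eq_Gamma h1]
  refine mul_le_mul_of_nonneg_left ?_ (by positivity)
  have h := Real.Gamma_mul_add_mul_le_rpow_Gamma_mul_rpow_Gamma hy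
    (t := j + 1 - α + 1) (by positivity) (sub_pos.2 h1) h0 (by ring)
  have e : (1 - α) * ((j : ℝ) + 1 - α) + α * (j + 1 - α + 1) = j + 1 := by ring
  rw [e, Real.Gamma_add_one hy.ne', Real.mul_rpow hy.le hG.le] at h
  have h2 : Real.Gamma (j + 1) ≤ Real.Gamma (j + 1 - α) * (j + 1) ^ α := by
    calc _ ≤ _ := h
      _ = (j + 1 - α) ^ α * (Real.Gamma (j + 1 - α) ^ (1 - α) * Real.Gamma (j + 1 - α) ^ α) := by
          ring
      _ = (j + 1 - α) ^ α * Real.Gamma (j + 1 - α) := by rw [← Real.rpow_add hG]; simp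
      _ ≤ (j + 1 : ℝ) ^ α * Real.Gamma (j + 1 - α) := by
          gcongr
          linarith
      _ = _ := mul_comm _ _
  rw [le_div_iff₀ hG2, Real.rpow_neg (by positivity), inv_mul_le_iff₀ (by positivity), mul_comm]
  exact h2

theorem cqCumWeight_le {α : ℝ} (h0 : 0 < α) (h1 : α < 1) {j : ℕ} (hj : 1 ≤ j) :
    cqCumWeight α j ≤ 1 / Real.Gamma (1 - α) * (j : ℝ) ^ (-α) := by
  have hG1 := Real.Gamma_pos_of_pos (sub_pos.2 h1)
  have hj : (0 : ℝ) < j := by exact_mod_cast hj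
  have hG := Real.Gamma_pos_of_pos hj
  have hG2 := Real.Gamma_pos_of_pos (show (0 : ℝ) < j + 1 by positivity)
  rw [cqCumWeight_eq_Gamma h1]
  refine mul_le_mul_of_nonneg_left ?_ (by positivity)
  have h := Real.Gamma_mul_add_mul_le_rpow_Gamma_mul_rpow_Gamma hj
    (t := j + 1) (by positivity) h0 (sub_pos.2 h1) (by ring)
  have e : α * (j : ℝ) + (1 - α) * (j + 1) = j + 1 - α := by ring
  rw [e] at h
  rw [div_le_iff₀ hG2]
  refine h.trans_eq ?_
  rw [Real.Gamma_add_one hj.ne', Real.mul_rpow hj.le hG.le]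
  calc _ = (Real.Gamma j ^ α * Real.Gamma j ^ (1 - α)) * (j : ℝ) ^ (1 - α) := by ring
    _ = Real.Gamma j * (j : ℝ) ^ (1 - α) := by rw [← Real.rpow_add hG]; simp
    _ = _ := by rw [sub_eq_neg_add, Real.rpow_add_one hj.ne']; ring

theorem rpow_neg_sub_rpow_neg_le {a b p : ℝ} (ha : 0 < a) (hb : 0 < b) (hp : 0 ≤ p) :
    a ^ (-p) - b ^ (-p) ≤ p * a ^ (-p - 1) * (b - a) := by
  have hx : 0 < b / a := by positivity
  have h1 : 1 - p * (b / a - 1) ≤ (b / a) ^ (-p) := by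
    rw [Real.rpow_def_of_pos hx]
    have h2 := Real.add_one_le_exp (Real.log (b / a) * -p)
    have h3 := Real.log_le_sub_one_of_pos hx
    nlinarith
  rw [Real.div_rpow hb.le ha.le, le_div_iff₀ (by positivity)] at h1
  rw [Real.rpow_sub_one ha.ne']
  have : 0 < a ^ (-p) := by positivity
  have e : p * (a ^ (-p) / a) * (b - a) = p * (b / a - 1) * a ^ (-p) := by field_simp
  rw [e]
  linarith

/-- The kernel of the consistency error on the cell `[j, j + 1]`. -/
noncomputable def cqKernel (α : ℝ) (j : ℕ) (t : ℝ) : ℝ :=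
  1 / Real.Gamma (1 - α) * t ^ (-α) - cqCumWeight α j

/-- The primitive of the consistency error kernel on the cell `[j, j + 1]`. -/
noncomputable def cqKernelPrim (α : ℝ) (j : ℕ) (t : ℝ) : ℝ :=
  1 / Real.Gamma (1 - α) * (t ^ (1 - α) / (1 - α))
    - (j * cqCumWeight α j / (1 - α) + (t - j) * cqCumWeight α j)

theorem cqKernelPrim_succ {α : ℝ} (h1 : α < 1) (j : ℕ) :
    cqKernelPrim α (j + 1) ((j + 1 : ℕ) : ℝ) = cqKernelPrim α j ((j + 1 : ℕ) : ℝ) := by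
  have h2 : 1 - α ≠ 0 := (sub_pos.2 h1).ne'
  rw [cqKernelPrim, cqKernelPrim, ← sum_cqCumWeight h1, ← sum_cqCumWeight h1,
    Finset.sum_range_succ]
  push_cast
  ring

theorem hasDerivAt_cqKernelPrim {α : ℝ} (h1 : α < 1) (j : ℕ) {t : ℝ} (ht : 0 < t) :
    HasDerivAt (cqKernelPrim α j) (cqKernel α j t) t := by
  have h2 : 1 - α ≠ 0 := (sub_pos.2 h1).ne'
  have h := (((Real.hasDerivAt_rpow_const (p := 1 - α) (Or.inl ht.ne')).div_const (1 - α)).const_mul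
    (1 / Real.Gamma (1 - α))).sub
    ((((hasDerivAt_id t).sub_const (j : ℝ)).mul_const (cqCumWeight α j)).const_add
      (j * cqCumWeight α j / (1 - α)))
  convert! h using 1
  rw [cqKernel]
  have e : 1 - α - 1 = -α := by ring
  rw [e]
  field_simp

theorem abs_cqKernel_le {α : ℝ} (h0 : 0 < α) (h1 : α < 1) {j : ℕ} (hj : 1 ≤ j) {t : ℝ}
    (h2 : (j : ℝ) ≤ t) (h3 : t ≤ j + 1) :
    |cqKernel α j t| ≤ 1 / Real.Gamma (1 - α) * α * (j : ℝ) ^ (-α - 1) := by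
  have hG1 : 0 < 1 / Real.Gamma (1 - α) := one_div_pos.2 (Real.Gamma_pos_of_pos (sub_pos.2 h1))
  have hj0 : (0 : ℝ) < j := by exact_mod_cast hj
  have a1 := le_cqCumWeight h0 h1 j
  have a2 := cqCumWeight_le h0 h1 hj
  have a3 : t ^ (-α) ≤ (j : ℝ) ^ (-α) := Real.rpow_le_rpow_of_nonpos hj0 h2 (by linarith)
  have a4 : (j + 1 : ℝ) ^ (-α) ≤ t ^ (-α) :=
    Real.rpow_le_rpow_of_nonpos (hj0.trans_le h2) h3 (by linarith)
  have a5 := rpow_neg_sub_rpow_neg_le hj0 (show (0 : ℝ) < j + 1 by positivity) h0.le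
  rw [add_sub_cancel_left, mul_one] at a5
  have a3' := mul_le_mul_of_nonneg_left a3 hG1.le
  have a4' := mul_le_mul_of_nonneg_left a4 hG1.le
  have a5' := mul_le_mul_of_nonneg_left a5 hG1.le
  rw [mul_sub] at a5'
  rw [cqKernel, mul_assoc]
  exact abs_le.2 ⟨by linarith, by linarith⟩

theorem abs_cqKernel_succ_sub_le {α : ℝ} (h0 : 0 < α) (h1 : α < 1) {j : ℕ} (hj : 1 ≤ j) {t : ℝ}
    (h2 : (j : ℝ) + 1 ≤ t) (h3 : t ≤ j + 2) :
    |cqKernel α (j + 1) t - cqKernel α j (t - 1)|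
      ≤ 1 / Real.Gamma (1 - α) * (2 * α * (α + 1)) * (j : ℝ) ^ (-α - 2) := by
  have hG1 : 0 < 1 / Real.Gamma (1 - α) := one_div_pos.2 (Real.Gamma_pos_of_pos (sub_pos.2 h1))
  set γ := 1 / Real.Gamma (1 - α) with hγ
  have hj0 : (0 : ℝ) < j := by exact_mod_cast hj
  have ht : 0 < t := by linarith
  have ht1 : 0 < t - 1 := by linarith
  have a1 := le_cqCumWeight h0 h1 j
  have a2 := cqCumWeight_le h0 h1 hj
  have hlo : (j + 2 : ℝ) ^ (-α - 1) ≤ t ^ (-α - 1) :=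
    Real.rpow_le_rpow_of_nonpos ht h3 (by linarith)
  have hhi : (t - 1) ^ (-α - 1) ≤ (j : ℝ) ^ (-α - 1) :=
    Real.rpow_le_rpow_of_nonpos hj0 (by linarith) (by linarith)
  have b1 := rpow_neg_sub_rpow_neg_le ht1 ht h0.le
  have b2 := rpow_neg_sub_rpow_neg_le ht ht1 h0.le
  rw [show t - (t - 1) = 1 by ring, mul_one] at b1
  rw [show t - 1 - t = -1 by ring] at b2
  have b3 := rpow_neg_sub_rpow_neg_le hj0 (show (0 : ℝ) < j + 2 by positivity)
    (show 0 ≤ α + 1 by linarith)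
  rw [show -(α + 1) = -α - 1 by ring, show -α - 1 - 1 = -α - 2 by ring, add_sub_cancel_left] at b3
  have c1 : γ * (j + 2 : ℝ) ^ (-α - 1) ≤ 1 / (j + 1) * cqCumWeight α j := by
    calc γ * (j + 2 : ℝ) ^ (-α - 1) ≤ γ * (j + 1 : ℝ) ^ (-α - 1) :=
          mul_le_mul_of_nonneg_left
            (Real.rpow_le_rpow_of_nonpos (by positivity) (by linarith) (by linarith)) hG1.le
      _ = 1 / (j + 1) * (γ * (j + 1 : ℝ) ^ (-α)) := by
          rw [Real.rpow_sub_one (by positivity)]; field_simp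
      _ ≤ _ := by gcongr
  have c2 : 1 / (j + 1) * cqCumWeight α j ≤ γ * (j : ℝ) ^ (-α - 1) := by
    calc _ ≤ 1 / (j : ℝ) * (γ * (j : ℝ) ^ (-α)) := by
          refine mul_le_mul (one_div_le_one_div_of_le hj0 (by linarith)) a2 ?_ (by positivity)
          exact le_trans (by positivity) a1
      _ = _ := by rw [Real.rpow_sub_one hj0.ne']; field_simp
  have e : cqKernel α (j + 1) t - cqKernel α j (t - 1)
      = α * (1 / (j + 1) * cqCumWeight α j) - γ * ((t - 1) ^ (-α) - t ^ (-α)) := by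
    rw [cqKernel, cqKernel, cqCumWeight_succ_eq_add, cqWeight_succ]
    ring
  have c1' := mul_le_mul_of_nonneg_left c1 h0.le
  have c2' := mul_le_mul_of_nonneg_left c2 h0.le
  have d1 : γ * ((t - 1) ^ (-α) - t ^ (-α)) ≤ γ * (α * (j : ℝ) ^ (-α - 1)) := by
    refine mul_le_mul_of_nonneg_left (b1.trans ?_) hG1.le
    gcongr
  have d2 : γ * (α * (j + 2 : ℝ) ^ (-α - 1)) ≤ γ * ((t - 1) ^ (-α) - t ^ (-α)) := by
    refine mul_le_mul_of_nonneg_left ?_ hG1.le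
    have := mul_le_mul_of_nonneg_left hlo h0.le
    linarith
  have d3 := mul_le_mul_of_nonneg_left b3 (show 0 ≤ γ * α by positivity)
  rw [e]
  exact abs_le.2 ⟨by linarith, by linarith⟩

theorem cqKernelPrim_zero_zero {α : ℝ} (h1 : α < 1) : cqKernelPrim α 0 0 = 0 := by
  have h2 : 1 - α ≠ 0 := (sub_pos.2 h1).ne'
  simp [cqKernelPrim, Real.zero_rpow h2]

theorem continuous_cqKernelPrim {α : ℝ} (h1 : α < 1) (j : ℕ) : Continuous (cqKernelPrim α j) := by
  have h := Real.continuous_rpow_const (sub_pos.2 h1).le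
  unfold cqKernelPrim
  fun_prop

theorem exists_abs_cqKernelPrim_le {α : ℝ} (h0 : 0 < α) (h1 : α < 1) :
    ∃ C, 0 ≤ C ∧ ∀ (j : ℕ) (t : ℝ), (j : ℝ) ≤ t → t ≤ j + 1 →
      |cqKernelPrim α j t| ≤ C * (j + 1 : ℝ) ^ (-α) := by
  have hG1 : 0 < 1 / Real.Gamma (1 - α) := one_div_pos.2 (Real.Gamma_pos_of_pos (sub_pos.2 h1))
  set γ := 1 / Real.Gamma (1 - α) with hγ
  have h2 : 0 < 1 - α := sub_pos.2 h1
  refine ⟨2 * (γ / (1 - α) + γ + 1), by positivity, fun j t hjt htj => ?_⟩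
  rcases Nat.eq_zero_or_pos j with rfl | hj
  · simp only [Nat.cast_zero, zero_add] at *
    have a1 : t ^ (1 - α) ≤ 1 := Real.rpow_le_one hjt htj h2.le
    have a2 : 0 ≤ t ^ (1 - α) := by positivity
    rw [Real.one_rpow, mul_one, cqKernelPrim, cqCumWeight_zero, ← hγ]
    have a3 : γ * (t ^ (1 - α) / (1 - α)) ≤ γ / (1 - α) := by
      rw [mul_div_assoc']
      gcongr
      nlinarith
    have a4 : 0 ≤ γ * (t ^ (1 - α) / (1 - α)) := by positivity
    have a5 : 0 ≤ γ / (1 - α) := by positivity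
    norm_num
    exact abs_le.2 ⟨by linarith, by linarith⟩
  · have hj1 : (1 : ℝ) ≤ j := by exact_mod_cast hj
    have hj0 : (0 : ℝ) < j := by linarith
    have a1 := le_cqCumWeight h0 h1 j
    have a2 := cqCumWeight_le h0 h1 hj
    have a5 := rpow_neg_sub_rpow_neg_le hj0 (show (0 : ℝ) < j + 1 by positivity) h0.le
    rw [add_sub_cancel_left, mul_one] at a5
    have a5' := mul_le_mul_of_nonneg_left a5 hG1.le
    rw [mul_sub] at a5'
    rw [← hγ] at a1 a2
    set P := (j : ℝ) ^ (-α) with hP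
    have hP0 : 0 < P := by positivity
    have hPj : (j : ℝ) ^ (-α - 1) = P / j := by rw [Real.rpow_sub_one hj0.ne']
    rw [hPj] at a5'
    set W := cqCumWeight α j with hW
    have hb : t ^ (1 - α) ≤ P * j + (1 - α) * P * (t - j) := by
      have hx : -1 ≤ (t - j) / j := by
        have : 0 ≤ (t - j) / j := div_nonneg (by linarith) hj0.le
        linarith
      have h := rpow_one_add_le_one_add_mul_self hx h2.le (by linarith : 1 - α ≤ 1)
      have e : t = j * (1 + (t - j) / j) := by field_simp; ring
      have e2 : (j : ℝ) ^ (1 - α) = P * j := by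
        rw [hP, sub_eq_neg_add, Real.rpow_add_one hj0.ne']
      rw [e, Real.mul_rpow hj0.le (by linarith), e2]
      calc _ ≤ P * j * (1 + (1 - α) * ((t - j) / j)) := by gcongr
        _ = P * j + (1 - α) * P * (j * (1 + (t - j) / j) - j) := by field_simp; ring
    have hb2 : P * j ≤ t ^ (1 - α) := by
      rw [hP, ← Real.rpow_add_one hj0.ne', ← sub_eq_neg_add]
      exact Real.rpow_le_rpow hj0.le hjt h2.le
    have hPP : P ≤ 2 * (j + 1 : ℝ) ^ (-α) := by
      have h3 : (2 * j : ℝ) ^ (-α) ≤ (j + 1 : ℝ) ^ (-α) :=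
        Real.rpow_le_rpow_of_nonpos (by positivity) (by linarith) (by linarith)
      rw [Real.mul_rpow (by norm_num) hj0.le] at h3
      have h4 : (2 : ℝ) ^ (-1 : ℝ) ≤ 2 ^ (-α) :=
        Real.rpow_le_rpow_of_exponent_le (by norm_num) (by linarith)
      rw [Real.rpow_neg_one] at h4
      nlinarith
    set q := t - (j : ℝ) with hq
    have hq0 : 0 ≤ q := by linarith
    have hq1 : q ≤ 1 := by linarith
    set ε := γ * P - W with hε
    have hε0 : 0 ≤ ε := by linarith
    have hε1 : ε * j ≤ γ * P := by
      have : ε ≤ γ * (α * (P / j)) := by linarith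
      calc ε * j ≤ γ * (α * (P / j)) * j := by gcongr
        _ = γ * P * α := by field_simp
        _ ≤ γ * P * 1 := by gcongr
        _ = _ := mul_one _
    have hε2 : ε ≤ γ * P := by nlinarith
    have e : cqKernelPrim α j t = γ * ((t ^ (1 - α) - P * j) / (1 - α) - q * P)
        + ε * j / (1 - α) + ε * q := by
      rw [cqKernelPrim, ← hγ, ← hW, ← hq, show W = γ * P - ε by rw [hε]; ring]
      field_simp
      ring
    have f1 : 0 ≤ (t ^ (1 - α) - P * j) / (1 - α) := div_nonneg (by linarith) h2.le
    have f2 : (t ^ (1 - α) - P * j) / (1 - α) ≤ P * q := by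
      rw [div_le_iff₀ h2]; linarith
    have f3 : ε * j / (1 - α) ≤ γ / (1 - α) * P := by
      rw [div_mul_eq_mul_div]; gcongr
    have f4 : 0 ≤ ε * j / (1 - α) := by positivity
    have f5 : ε * q ≤ γ * P := by nlinarith
    have f6 : 0 ≤ ε * q := by positivity
    have f7 : q * P ≤ P := by nlinarith
    have f8 : γ * ((t ^ (1 - α) - P * j) / (1 - α) - q * P) ≤ 0 :=
      mul_nonpos_of_nonneg_of_nonpos hG1.le (by linarith)
    have f9 : -(γ * P) ≤ γ * ((t ^ (1 - α) - P * j) / (1 - α) - q * P) := by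
      rw [← mul_neg]
      exact mul_le_mul_of_nonneg_left (by linarith) hG1.le
    have f10 : |cqKernelPrim α j t| ≤ (γ / (1 - α) + γ + 1) * P := by
      rw [e]
      have : 0 ≤ γ / (1 - α) * P := by positivity
      exact abs_le.2 ⟨by linarith, by linarith⟩
    refine f10.trans ?_
    have : 0 ≤ γ / (1 - α) + γ + 1 := by positivity
    calc _ ≤ (γ / (1 - α) + γ + 1) * (2 * (j + 1 : ℝ) ^ (-α)) := by gcongr
      _ = _ := by ring

theorem sum_rpow_neg_le {α : ℝ} (h0 : 0 < α) (h1 : α < 1) {J : ℕ} (hJ : 1 ≤ J) :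
    ∑ i ∈ Finset.range J, (i + 1 : ℝ) ^ (-α) ≤ (J : ℝ) ^ (1 - α) / (1 - α) := by
  have hG1 : 0 < 1 / Real.Gamma (1 - α) := one_div_pos.2 (Real.Gamma_pos_of_pos (sub_pos.2 h1))
  have hJ0 : (0 : ℝ) < J := by exact_mod_cast hJ
  have h2 : 0 < 1 - α := sub_pos.2 h1
  refine le_of_mul_le_mul_left ?_ hG1
  rw [Finset.mul_sum]
  calc _ ≤ ∑ i ∈ Finset.range J, cqCumWeight α i := Finset.sum_le_sum fun i _ => le_cqCumWeight h0 h1 i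
    _ = J * cqCumWeight α J / (1 - α) := sum_cqCumWeight h1 J
    _ ≤ J * (1 / Real.Gamma (1 - α) * (J : ℝ) ^ (-α)) / (1 - α) := by
        have := cqCumWeight_le h0 h1 hJ
        gcongr
    _ = _ := by
        rw [sub_eq_neg_add, Real.rpow_add_one hJ0.ne']
        ring

open MeasureTheory intervalIntegral in
theorem intervalIntegrable_of_hasDerivAt_nonpos {f f1 : ℝ → ℝ} (hf : ContinuousOn f (Set.Ici 0))
    (hd : ∀ s, 0 < s → HasDerivAt f (f1 s) s) (hneg : ∀ s, 0 < s → f1 s ≤ 0) {a b : ℝ}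
    (ha : 0 ≤ a) (hab : a ≤ b) :
    IntervalIntegrable f1 volume a b ∧ ∫ s in a..b, f1 s = f b - f a := by
  have hc : ContinuousOn f (Set.Icc a b) := hf.mono fun x hx => ha.trans hx.1
  have hd' : ∀ x ∈ Set.Ioo a b, HasDerivAt f (f1 x) x := fun x hx => hd x (ha.trans_lt hx.1)
  have h := integrableOn_deriv_of_nonneg hc.neg (fun x hx => (hd' x hx).neg)
    fun x hx => neg_nonneg.2 (hneg x (ha.trans_lt hx.1))
  have h2 : IntervalIntegrable f1 volume a b := by
    rw [intervalIntegrable_iff_integrableOn_Ioc_of_le hab]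
    simpa using h.neg
  exact ⟨h2, integral_eq_sub_of_hasDerivAt_of_le hab hc hd' h2⟩

theorem sum_cqWeight_mul (α : ℝ) (φ : ℕ → ℝ) (m : ℕ) :
    ∑ j ∈ Finset.range (m + 1), cqWeight α j * φ j
      = ∑ j ∈ Finset.range m, cqCumWeight α j * (φ j - φ (j + 1)) + cqCumWeight α m * φ m := by
  induction m with
  | zero => simp [cqCumWeight]
  | succ m ih =>
    rw [Finset.sum_range_succ, ih, Finset.sum_range_succ _ m, cqCumWeight_succ_eq_add]
    ring

open MeasureTheory intervalIntegral in
theorem cqError_one_eq_sum {α : ℝ} {f f1 : ℝ → ℝ} (hf : ContinuousOn f (Set.Ici 0))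
    (hd : ∀ s, 0 < s → HasDerivAt f (f1 s) s) (hneg : ∀ s, 0 < s → f1 s ≤ 0) (n : ℕ)
    (hi : IntegrableOn (fun s => ((n : ℝ) - s) ^ (-α) * f1 s) (Set.Ioo 0 n)) :
    cqError α 1 f f1 (f 0) n
      = ∑ j ∈ Finset.range n, ∫ t in (j : ℝ)..(j + 1 : ℕ), cqKernel α j t * f1 (n - t) := by
  have hn : (0 : ℝ) ≤ n := n.cast_nonneg
  have hi' : IntervalIntegrable (fun t : ℝ => t ^ (-α) * f1 (n - t)) volume 0 n := by
    have h : IntervalIntegrable (fun s => ((n : ℝ) - s) ^ (-α) * f1 s) volume 0 n := by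
      rwa [intervalIntegrable_iff_integrableOn_Ioo_of_le hn]
    have := (h.comp_sub_left (n : ℝ)).symm
    simpa using this
  have hcell : ∀ j < n, Set.uIcc (j : ℝ) (j + 1 : ℕ) ⊆ Set.uIcc (0 : ℝ) n := fun j hj => by
    have h1 : ((j + 1 : ℕ) : ℝ) ≤ n := by exact_mod_cast hj
    have h2 : (j : ℝ) ≤ (j + 1 : ℕ) := by push_cast; linarith
    rw [Set.uIcc_of_le h2, Set.uIcc_of_le hn]
    exact Set.Icc_subset_Icc j.cast_nonneg h1
  have hF : ∀ j < n, IntervalIntegrable (fun t => f1 (n - t)) volume (j : ℝ) (j + 1 : ℕ) ∧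
      ∫ t in (j : ℝ)..(j + 1 : ℕ), f1 (n - t)
        = f ((n - j : ℕ) : ℝ) - f ((n - (j + 1) : ℕ) : ℝ) := fun j hj => by
    have h := intervalIntegrable_of_hasDerivAt_nonpos hf hd hneg
      (a := ((n - (j + 1) : ℕ) : ℝ)) (b := ((n - j : ℕ) : ℝ)) (by positivity)
      (by exact_mod_cast Nat.sub_le_sub_left (Nat.le_succ j) n)
    have e1 : ((n - (j + 1) : ℕ) : ℝ) = n - (j + 1 : ℕ) := by rw [Nat.cast_sub hj]
    have e2 : ((n - j : ℕ) : ℝ) = n - (j : ℝ) := by rw [Nat.cast_sub hj.le]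
    refine ⟨?_, ?_⟩
    · have h3 := (h.1.comp_sub_left (n : ℝ)).symm
      rw [e1, e2] at h3
      simpa using h3
    · rw [integral_comp_sub_left (fun s => f1 s), ← h.2, e1, e2]
  have hK : caputo α f1 ((n : ℝ) * 1)
      = ∑ j ∈ Finset.range n, ∫ t in (j : ℝ)..(j + 1 : ℕ),
          1 / Real.Gamma (1 - α) * (t ^ (-α) * f1 (n - t)) := by
    rw [caputo, mul_one, ← integral_Ioc_eq_integral_Ioo, ← integral_of_le hn]
    simp_rw [intervalIntegral.integral_const_mul]
    rw [← Finset.mul_sum]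
    have h := sum_integral_adjacent_intervals (a := fun k : ℕ => (k : ℝ)) (n := n)
      (f := fun t : ℝ => t ^ (-α) * f1 (n - t)) (μ := volume)
      fun k hk => hi'.mono_set (hcell k hk)
    rw [h]
    have h2 := integral_comp_sub_left (a := 0) (b := (n : ℝ))
      (fun t : ℝ => t ^ (-α) * f1 (n - t)) (n : ℝ)
    simp only [sub_sub_cancel, sub_self, sub_zero] at h2
    simp only [smul_eq_mul, Nat.cast_zero]
    rw [h2]
  have hS : ∑ j ∈ Finset.range (n + 1), cqWeight α j • (f (((n - j : ℕ) : ℝ) * 1) - f 0)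
      = ∑ j ∈ Finset.range n, cqCumWeight α j * ∫ t in (j : ℝ)..(j + 1 : ℕ), f1 (n - t) := by
    simp only [smul_eq_mul, mul_one]
    rw [sum_cqWeight_mul α (fun j => f ((n - j : ℕ) : ℝ) - f 0)]
    simp only [Nat.sub_self, Nat.cast_zero, sub_self, mul_zero, add_zero]
    refine Finset.sum_congr rfl fun j hj => ?_
    rw [(hF j (Finset.mem_range.1 hj)).2]
    ring
  rw [cqError, hK, hS, Real.one_rpow, one_smul, ← Finset.sum_sub_distrib]
  refine Finset.sum_congr rfl fun j hj => ?_
  have hj := Finset.mem_range.1 hj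
  rw [← intervalIntegral.integral_const_mul, ← intervalIntegral.integral_sub
    ((hi'.mono_set (hcell j hj)).const_mul _) ((hF j hj).1.const_mul _)]
  refine integral_congr fun t _ => ?_
  simp only [cqKernel]
  ring

open MeasureTheory intervalIntegral in
theorem abs_cqError_one_le {α : ℝ} (h0 : 0 < α) (h1 : α < 1) {f f1 : ℝ → ℝ} {M : ℝ}
    (hf : ContinuousOn f (Set.Ici 0))
    (hd : ∀ s, 0 < s → HasDerivAt f (f1 s) s) (hneg : ∀ s, 0 < s → f1 s ≤ 0) {n : ℕ} (hn : 1 ≤ n)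
    (hM : ∀ s : ℝ, 0 ≤ s → s ≤ n → |f s - f 0| ≤ M) (hM1 : ∀ s : ℝ, 0 < s → s ≤ n → |f1 s| ≤ M / s) :
    |cqError α 1 f f1 (f 0) n|
      ≤ (1 / Real.Gamma (1 - α) * (2 + 2 * ((n : ℝ) ^ (1 - α) / (1 - α)))
          + ∑ j ∈ Finset.range (n + 1), |cqWeight α j|) * M := by
  have hG1 : 0 < 1 / Real.Gamma (1 - α) := one_div_pos.2 (Real.Gamma_pos_of_pos (sub_pos.2 h1))
  have hn1 : (1 : ℝ) ≤ n := by exact_mod_cast hn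
  have hn0 : (0 : ℝ) ≤ n := by linarith
  have hM0 : 0 ≤ M := (abs_nonneg _).trans (hM 0 le_rfl hn0)
  obtain ⟨hF1, hF2⟩ := intervalIntegrable_of_hasDerivAt_nonpos hf hd hneg le_rfl hn0
  have hF1n : IntervalIntegrable (fun s => -f1 s) volume 0 n := hF1.neg
  have hr : IntervalIntegrable (fun s : ℝ => ((n : ℝ) - s) ^ (-α)) volume 0 n := by
    have h := ((intervalIntegrable_rpow' (a := 0) (b := n)
      (show -1 < -α by linarith)).comp_sub_left (n : ℝ)).symm
    simpa using h
  have hr2 : ∫ s in (0 : ℝ)..n, ((n : ℝ) - s) ^ (-α) = (n : ℝ) ^ (1 - α) / (1 - α) := by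
    rw [integral_comp_sub_left (fun s : ℝ => s ^ (-α)), integral_rpow (Or.inl (by linarith))]
    rw [sub_self, sub_zero, show -α + 1 = 1 - α by ring, Real.zero_rpow (by linarith), sub_zero]
  have hpt : ∀ s : ℝ, 0 < s → s < n →
      |((n : ℝ) - s) ^ (-α) * f1 s| ≤ 2 * -f1 s + 2 * M * ((n : ℝ) - s) ^ (-α) := by
    intro s hs hsn
    have p1 : 0 < (n : ℝ) - s := by linarith
    have p2 : 0 < ((n : ℝ) - s) ^ (-α) := by positivity
    have p3 := hneg s hs
    rw [abs_mul, abs_of_pos p2, abs_of_nonpos p3]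
    rcases le_total ((n : ℝ) - s) (1 / 2) with h | h
    · have q := hM1 s hs hsn.le
      rw [abs_of_nonpos p3, le_div_iff₀ hs] at q
      have : -f1 s ≤ 2 * M := by nlinarith
      nlinarith
    · have q : ((n : ℝ) - s) ^ (-α) ≤ (1 / 2) ^ (-α) :=
        Real.rpow_le_rpow_of_nonpos (by norm_num) h (by linarith)
      have q2 : (1 / 2 : ℝ) ^ (-α) ≤ 2 := by
        rw [one_div, Real.inv_rpow (by norm_num), Real.rpow_neg (by norm_num), inv_inv]
        calc (2 : ℝ) ^ α ≤ 2 ^ (1 : ℝ) :=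
              Real.rpow_le_rpow_of_exponent_le (by norm_num) h1.le
          _ = 2 := Real.rpow_one 2
      have : 0 ≤ 2 * M * ((n : ℝ) - s) ^ (-α) := by positivity
      nlinarith
  have hint : |∫ s in (0 : ℝ)..n, ((n : ℝ) - s) ^ (-α) * f1 s|
      ≤ (2 + 2 * ((n : ℝ) ^ (1 - α) / (1 - α))) * M := by
    have h := norm_integral_le_of_norm_le (μ := volume) hn0
      (f := fun s => ((n : ℝ) - s) ^ (-α) * f1 s)
      (g := fun s => 2 * -f1 s + 2 * M * ((n : ℝ) - s) ^ (-α)) ?_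
      ((hF1n.const_mul 2).add (hr.const_mul (2 * M)))
    · rw [intervalIntegral.integral_add (hF1n.const_mul 2) (hr.const_mul (2 * M)),
        intervalIntegral.integral_const_mul, intervalIntegral.integral_const_mul,
        intervalIntegral.integral_neg, hF2, hr2] at h
      have h3 := abs_le.1 (hM n hn0 le_rfl)
      rw [Real.norm_eq_abs] at h
      linarith
    · have hne : ∀ᵐ s : ℝ ∂volume, s ≠ n := by
        simp [ae_iff]
      filter_upwards [hne] with s hs hs2
      exact hpt s hs2.1 (lt_of_le_of_ne hs2.2 hs)
  have hS : |∑ j ∈ Finset.range (n + 1), cqWeight α j • (f (((n - j : ℕ) : ℝ) * 1) - f 0)|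
      ≤ (∑ j ∈ Finset.range (n + 1), |cqWeight α j|) * M := by
    rw [Finset.sum_mul]
    refine (Finset.abs_sum_le_sum_abs _ _).trans (Finset.sum_le_sum fun j _ => ?_)
    rw [smul_eq_mul, abs_mul, mul_one]
    refine mul_le_mul_of_nonneg_left (hM _ (by positivity) ?_) (abs_nonneg _)
    exact_mod_cast Nat.sub_le n j
  rw [cqError, Real.one_rpow, one_smul, caputo, mul_one, ← integral_Ioc_eq_integral_Ioo,
    ← integral_of_le hn0]
  simp only [smul_eq_mul] at hS ⊢
  refine (abs_sub _ _).trans ?_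
  rw [abs_mul, abs_of_pos hG1, add_mul, mul_assoc]
  gcongr

theorem rpow_neg_le_of_div_four_le {N J p : ℝ} (hN : 0 < N) (hJ : N / 4 ≤ J) (hp : 0 ≤ p) :
    J ^ (-p) ≤ 4 ^ p * N ^ (-p) := by
  have h : J ^ (-p) ≤ (N / 4) ^ (-p) :=
    Real.rpow_le_rpow_of_nonpos (by positivity) hJ (by linarith)
  rw [Real.div_rpow hN.le (by norm_num), Real.rpow_neg (by norm_num : (0 : ℝ) ≤ 4),
    div_inv_eq_mul, mul_comm] at h
  exact h

theorem abs_sub_le_of_hasDerivAt_of_abs_le {g g' : ℝ → ℝ} {B x y : ℝ} (hxy : x ≤ y)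
    (hd : ∀ s, x ≤ s → s ≤ y → HasDerivAt g (g' s) s) (hB : ∀ s, x ≤ s → s ≤ y → |g' s| ≤ B) :
    |g y - g x| ≤ B * (y - x) := by
  have h := Convex.norm_image_sub_le_of_norm_hasDerivWithin_le (s := Set.Icc x y) (x := x) (y := y)
    (fun s hs => (hd s hs.1 hs.2).hasDerivWithinAt) (fun s hs => hB s hs.1 hs.2)
    (convex_Icc x y) (Set.left_mem_Icc.2 hxy) (Set.right_mem_Icc.2 hxy)
  rwa [Real.norm_eq_abs, Real.norm_eq_abs, abs_of_nonneg (sub_nonneg.2 hxy)] at h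

theorem abs_le_of_abs_le_div_pow {g : ℝ → ℝ} {M N : ℝ} {k : ℕ} (hN : 0 < N)
    (h : ∀ s : ℝ, 0 < s → s ≤ N → |g s| ≤ M / s ^ k) (hM : 0 ≤ M) {s : ℝ} (h1 : N / 4 ≤ s)
    (h2 : s ≤ N) : |g s| ≤ 4 ^ k * M / N ^ k := by
  have hN4 : 0 < N / 4 := by positivity
  refine (h s (hN4.trans_le h1) h2).trans ?_
  calc M / s ^ k ≤ M / (N / 4) ^ k := by gcongr
    _ = 4 ^ k * M / N ^ k := by rw [div_pow]; field_simp

theorem intervalIntegrable_cqKernel {α : ℝ} (h1 : α < 1) (j : ℕ) (a b : ℝ) :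
    IntervalIntegrable (cqKernel α j) MeasureTheory.volume a b :=
  ((intervalIntegral.intervalIntegrable_rpow' (show -1 < -α by linarith)).const_mul _).sub
    intervalIntegrable_const

open MeasureTheory intervalIntegral in
theorem exists_abs_sum_integral_cqKernel_mul_sub_le {α : ℝ} (h0 : 0 < α) (h1 : α < 1) :
    ∃ C, 0 ≤ C ∧ ∀ (f1 f2 f3 : ℝ → ℝ) (M : ℝ) (N J : ℕ), 1 ≤ J → 2 * J + 1 ≤ N → N ≤ 4 * J → 0 ≤ M →
      (∀ s, 0 < s → HasDerivAt f1 (f2 s) s) → (∀ s, 0 < s → HasDerivAt f2 (f3 s) s) →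
      (∀ s : ℝ, 0 < s → s ≤ N → |f2 s| ≤ M / s ^ 2) → (∀ s : ℝ, 0 < s → s ≤ N → |f3 s| ≤ M / s ^ 3) →
      |∑ j ∈ Finset.range J, ∫ t in (j : ℝ)..(j + 1 : ℕ),
          (f1 (N - t) - f1 (N - 1 - t)) * cqKernel α j t| ≤ C * M * (N : ℝ) ^ (-2 - α) := by
  obtain ⟨C, hC0, hC⟩ := exists_abs_cqKernelPrim_le h0 h1
  have h2 : 0 < 1 - α := sub_pos.2 h1
  refine ⟨64 * C + 64 * C / (1 - α), by positivity, fun f1 f2 f3 M N J hJ hJN hNJ hM d1 d2 b2 b3 => ?_⟩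
  have hJ1 : (1 : ℝ) ≤ J := by exact_mod_cast hJ
  have hJN' : 2 * (J : ℝ) + 1 ≤ N := by exact_mod_cast hJN
  have hNJ' : (N : ℝ) ≤ 4 * J := by exact_mod_cast hNJ
  have hN0 : (0 : ℝ) < N := by linarith
  have B2 : ∀ s, (N : ℝ) / 4 ≤ s → s ≤ N → |f2 s| ≤ 16 * M / N ^ 2 := fun s h h' => by
    have := abs_le_of_abs_le_div_pow hN0 b2 hM h h'
    norm_num at this ⊢; exact this
  have B3 : ∀ s, (N : ℝ) / 4 ≤ s → s ≤ N → |f3 s| ≤ 64 * M / N ^ 3 := fun s h h' => by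
    have := abs_le_of_abs_le_div_pow hN0 b3 hM h h'
    norm_num at this ⊢; exact this
  set h := fun t : ℝ => f1 (N - t) - f1 (N - 1 - t) with hh
  set h' := fun t : ℝ => -f2 (N - t) - -f2 (N - 1 - t) with hh'
  have hd : ∀ t : ℝ, t ≤ J → HasDerivAt h (h' t) t := fun t ht => by
    have e1 := (d1 (N - t) (by linarith)).comp_const_sub (N : ℝ) t
    have e2 := (d1 (N - 1 - t) (by linarith)).comp_const_sub (N - 1 : ℝ) t
    exact e1.sub e2
  have hh'c : ContinuousOn h' (Set.Iic (J : ℝ)) := fun t ht => by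
    have ht : t ≤ J := ht
    have e1 := (d2 (N - t) (by linarith)).comp_const_sub (N : ℝ) t
    have e2 := (d2 (N - 1 - t) (by linarith)).comp_const_sub (N - 1 : ℝ) t
    exact (e1.neg.sub e2.neg).continuousAt.continuousWithinAt
  have hhb : ∀ t : ℝ, 0 ≤ t → t ≤ J → |h t| ≤ 16 * M / N ^ 2 := fun t ht ht' => by
    have := abs_sub_le_of_hasDerivAt_of_abs_le (g := f1) (g' := f2) (x := N - 1 - t) (y := N - t)
      (by linarith) (fun s hs _ => d1 s (by linarith))
      (fun s hs hs' => B2 s (by linarith) (by linarith))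
    rwa [show (N : ℝ) - t - (N - 1 - t) = 1 by ring, mul_one] at this
  have hh'b : ∀ t : ℝ, 0 ≤ t → t ≤ J → |h' t| ≤ 64 * M / N ^ 3 := fun t ht ht' => by
    have := abs_sub_le_of_hasDerivAt_of_abs_le (g := f2) (g' := f3) (x := N - 1 - t) (y := N - t)
      (by linarith) (fun s hs _ => d2 s (by linarith))
      (fun s hs hs' => B3 s (by linarith) (by linarith))
    rw [show (N : ℝ) - t - (N - 1 - t) = 1 by ring, mul_one, abs_sub_comm] at this
    have e : h' t = f2 (N - 1 - t) - f2 (N - t) := by simp only [hh']; ring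
    rwa [e]
  have hcell : ∀ j ∈ Finset.range J, ∫ t in (j : ℝ)..(j + 1 : ℕ), h t * cqKernel α j t
      = (h (j + 1 : ℕ) * cqKernelPrim α (j + 1) (j + 1 : ℕ) - h j * cqKernelPrim α j j)
        - ∫ t in (j : ℝ)..(j + 1 : ℕ), h' t * cqKernelPrim α j t := fun j hj => by
    have hj : ((j + 1 : ℕ) : ℝ) ≤ J := by exact_mod_cast Finset.mem_range.1 hj
    have hjj : (j : ℝ) ≤ (j + 1 : ℕ) := by push_cast; linarith
    have hsub : Set.uIcc (j : ℝ) (j + 1 : ℕ) ⊆ Set.Iic (J : ℝ) := by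
      rw [Set.uIcc_of_le hjj]
      exact fun x hx => hx.2.trans hj
    rw [cqKernelPrim_succ h1]
    refine integral_mul_deriv_eq_deriv_mul_of_hasDerivAt
      (fun t ht => (hd t (hsub ht)).continuousAt.continuousWithinAt)
      (continuous_cqKernelPrim h1 j).continuousOn ?_ ?_ ?_
      (intervalIntegrable_cqKernel h1 j _ _)
    · intro t ht
      rw [max_eq_right hjj] at ht
      exact hd t (ht.2.le.trans hj)
    · intro t ht
      rw [min_eq_left hjj] at ht
      exact hasDerivAt_cqKernelPrim h1 j (lt_of_le_of_lt j.cast_nonneg ht.1)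
    · exact (hh'c.mono hsub).intervalIntegrable
  rw [Finset.sum_congr rfl hcell, Finset.sum_sub_distrib,
    Finset.sum_range_sub (fun j : ℕ => h j * cqKernelPrim α j j)]
  simp only [Nat.cast_zero, cqKernelPrim_zero_zero h1, mul_zero, sub_zero]
  have hbd : |h J * cqKernelPrim α J J| ≤ 64 * C * M * (N : ℝ) ^ (-2 - α) := by
    have e1 := hhb J (by linarith) le_rfl
    have e2 := hC J J le_rfl (by linarith)
    have e3 := rpow_neg_le_of_div_four_le hN0 (show (N : ℝ) / 4 ≤ J + 1 by linarith) h0.le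
    have e4 : (4 : ℝ) ^ α ≤ 4 := by
      simpa using Real.rpow_le_rpow_of_exponent_le (show (1 : ℝ) ≤ 4 by norm_num) h1.le
    have e5 : (J + 1 : ℝ) ^ (-α) ≤ 4 * (N : ℝ) ^ (-α) := e3.trans (by gcongr)
    rw [abs_mul]
    calc _ ≤ 16 * M / N ^ 2 * (C * (4 * (N : ℝ) ^ (-α))) := by
          refine mul_le_mul e1 (e2.trans ?_) (abs_nonneg _) (by positivity)
          gcongr
      _ = _ := by
          rw [show -2 - α = -α - (2 : ℕ) by push_cast; ring, Real.rpow_sub_natCast hN0.ne']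
          field_simp
          ring
  have hint : |∑ j ∈ Finset.range J, ∫ t in (j : ℝ)..(j + 1 : ℕ), h' t * cqKernelPrim α j t|
      ≤ 64 * C / (1 - α) * M * (N : ℝ) ^ (-2 - α) := by
    calc _ ≤ ∑ j ∈ Finset.range J, 64 * M / N ^ 3 * (C * (j + 1 : ℝ) ^ (-α)) := by
          refine (Finset.abs_sum_le_sum_abs _ _).trans (Finset.sum_le_sum fun j hj => ?_)
          have hj : ((j + 1 : ℕ) : ℝ) ≤ J := by exact_mod_cast Finset.mem_range.1 hj
          have hjj : (j : ℝ) ≤ (j + 1 : ℕ) := by push_cast; linarith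
          have := norm_integral_le_of_norm_le_const (a := (j : ℝ)) (b := (j + 1 : ℕ))
            (f := fun t => h' t * cqKernelPrim α j t) (C := 64 * M / N ^ 3 * (C * (j + 1 : ℝ) ^ (-α)))
            fun t ht => ?_
          · simpa using this
          · rw [Set.uIoc_of_le hjj] at ht
            have ht1 := ht.1.le
            have ht2 := ht.2
            rw [norm_mul]
            refine mul_le_mul (hh'b t (j.cast_nonneg.trans ht1) (ht2.trans hj))
              (hC j t ht1 (by push_cast at ht2; exact ht2)) (norm_nonneg _) (by positivity)
      _ = 64 * M / N ^ 3 * C * ∑ j ∈ Finset.range J, (j + 1 : ℝ) ^ (-α) := by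
          rw [Finset.mul_sum]
          exact Finset.sum_congr rfl fun j _ => by ring
      _ ≤ 64 * M / N ^ 3 * C * ((J : ℝ) ^ (1 - α) / (1 - α)) := by
          gcongr
          exact sum_rpow_neg_le h0 h1 hJ
      _ ≤ 64 * M / N ^ 3 * C * ((N : ℝ) ^ (1 - α) / (1 - α)) := by
          gcongr
          linarith
      _ = _ := by
          rw [show -2 - α = (1 - α) - (3 : ℕ) by push_cast; ring, Real.rpow_sub_natCast hN0.ne']
          field_simp
  refine (abs_sub _ _).trans ?_
  linarith

open MeasureTheory intervalIntegral in
theorem intervalIntegrable_comp_sub_of_hasDerivAt_nonpos {f f1 : ℝ → ℝ}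
    (hf : ContinuousOn f (Set.Ici 0)) (hd : ∀ s, 0 < s → HasDerivAt f (f1 s) s)
    (hneg : ∀ s, 0 < s → f1 s ≤ 0) {a b N : ℝ} (hab : a ≤ b) (hb : b ≤ N) :
    IntervalIntegrable (fun t => f1 (N - t)) volume a b ∧
      ∫ t in a..b, f1 (N - t) = f (N - a) - f (N - b) := by
  have h := intervalIntegrable_of_hasDerivAt_nonpos hf hd hneg (a := N - b) (b := N - a)
    (by linarith) (by linarith)
  refine ⟨?_, ?_⟩
  · have h3 := (h.1.comp_sub_left N).symm
    simpa using h3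
  · rw [integral_comp_sub_left (fun s => f1 s), ← h.2]

theorem continuousOn_cqKernel (α : ℝ) (j : ℕ) : ContinuousOn (cqKernel α j) (Set.Ioi 0) := by
  unfold cqKernel
  have h : ContinuousOn (fun t : ℝ => t ^ (-α)) (Set.Ioi 0) :=
    continuousOn_id.rpow_const fun x hx => Or.inl (ne_of_gt hx)
  fun_prop

theorem sum_range_succ_sub_sum_range_eq (a b : ℕ → ℝ) {J m : ℕ} (h : J ≤ m) :
    ∑ j ∈ Finset.range (m + 1), a j - ∑ j ∈ Finset.range m, b j
      = ∑ j ∈ Finset.range J, (a j - b j) + a J + ∑ j ∈ Finset.Ico J m, (a (j + 1) - b j) := by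
  induction m, h using Nat.le_induction with
  | base =>
    rw [Finset.sum_range_succ, Finset.sum_sub_distrib, Finset.Ico_self, Finset.sum_empty]
    ring
  | succ m hm ih =>
    rw [Finset.sum_range_succ, Finset.sum_range_succ b, Finset.sum_Ico_succ_top hm]
    linarith

open MeasureTheory intervalIntegral in
theorem integral_cqKernel_sub_integral_cqKernel {α : ℝ} {f f1 : ℝ → ℝ}
    (hf : ContinuousOn f (Set.Ici 0)) (hd : ∀ s, 0 < s → HasDerivAt f (f1 s) s)
    (hneg : ∀ s, 0 < s → f1 s ≤ 0) (h0 : 0 < α) (h1 : α < 1) {m j : ℕ} (hj : 1 ≤ j) (hjm : j < m) :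
    |(∫ t in ((j + 1 : ℕ) : ℝ)..(j + 1 + 1 : ℕ), cqKernel α (j + 1) t * f1 ((m + 1 : ℕ) - t))
        - ∫ t in (j : ℝ)..(j + 1 : ℕ), cqKernel α j t * f1 (m - t)|
      ≤ 1 / Real.Gamma (1 - α) * (2 * α * (α + 1)) * (j : ℝ) ^ (-α - 2)
        * (f ((m + 1 : ℕ) - (j + 1 + 1 : ℕ)) - f ((m + 1 : ℕ) - (j + 1 : ℕ))) := by
  have hj0 : (1 : ℝ) ≤ j := by exact_mod_cast hj
  have hjm' : ((j + 1 + 1 : ℕ) : ℝ) ≤ (m + 1 : ℕ) := by exact_mod_cast Nat.succ_le_succ hjm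
  have hab : ((j + 1 : ℕ) : ℝ) ≤ (j + 1 + 1 : ℕ) := by push_cast; linarith
  obtain ⟨i1, i2⟩ := intervalIntegrable_comp_sub_of_hasDerivAt_nonpos hf hd hneg hab hjm'
  have e := integral_comp_sub_right (a := ((j + 1 : ℕ) : ℝ)) (b := (j + 1 + 1 : ℕ))
    (fun t => cqKernel α j t * f1 (m - t)) 1
  rw [show ((j + 1 : ℕ) : ℝ) - 1 = j by push_cast; ring,
    show ((j + 1 + 1 : ℕ) : ℝ) - 1 = (j + 1 : ℕ) by push_cast; ring] at e
  have hsub : ∀ t ∈ Set.uIcc ((j + 1 : ℕ) : ℝ) (j + 1 + 1 : ℕ), (j : ℝ) + 1 ≤ t ∧ t ≤ j + 2 := by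
    intro t ht
    rw [Set.uIcc_of_le hab] at ht
    have := ht.1
    have := ht.2
    push_cast at *
    exact ⟨by linarith, by linarith⟩
  have c1 : ContinuousOn (cqKernel α (j + 1)) (Set.uIcc ((j + 1 : ℕ) : ℝ) (j + 1 + 1 : ℕ)) :=
    (continuousOn_cqKernel α (j + 1)).mono fun t ht => by
      have := (hsub t ht).1
      exact show 0 < t by linarith
  have c2 : ContinuousOn (fun t => cqKernel α j (t - 1))
      (Set.uIcc ((j + 1 : ℕ) : ℝ) (j + 1 + 1 : ℕ)) :=
    (continuousOn_cqKernel α j).comp (by fun_prop) fun t ht => by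
      have := (hsub t ht).1
      exact show 0 < t - 1 by linarith
  have e2 : (fun t : ℝ => cqKernel α j (t - 1) * f1 (m - (t - 1)))
      = fun t => cqKernel α j (t - 1) * f1 ((m + 1 : ℕ) - t) := by
    funext t
    rw [show (m : ℝ) - (t - 1) = (m + 1 : ℕ) - t by push_cast; ring]
  simp only [e2] at e
  rw [← e, ← intervalIntegral.integral_sub (i1.continuousOn_mul c1) (i1.continuousOn_mul c2)]
  have hb := norm_integral_le_of_norm_le (μ := volume) hab
    (f := fun t => cqKernel α (j + 1) t * f1 ((m + 1 : ℕ) - t)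
      - cqKernel α j (t - 1) * f1 ((m + 1 : ℕ) - t))
    (g := fun t => -(1 / Real.Gamma (1 - α) * (2 * α * (α + 1)) * (j : ℝ) ^ (-α - 2))
      * f1 ((m + 1 : ℕ) - t)) ?_ (i1.const_mul _)
  · rw [intervalIntegral.integral_const_mul, i2] at hb
    refine hb.trans_eq ?_
    ring
  · have hne : ∀ᵐ t : ℝ ∂volume, t ≠ (m + 1 : ℕ) := by simp [ae_iff]
    filter_upwards [hne] with t ht ht2
    obtain ⟨q1, q2⟩ := hsub t (by rw [Set.uIcc_of_le hab]; exact Set.Ioc_subset_Icc_self ht2)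
    have q3 : 0 < ((m + 1 : ℕ) : ℝ) - t := by
      have := lt_of_le_of_ne (ht2.2.trans hjm') ht
      linarith
    have q4 := hneg _ q3
    rw [← sub_mul, Real.norm_eq_abs, abs_mul, abs_of_nonpos q4, neg_mul, ← mul_neg]
    exact mul_le_mul_of_nonneg_right (abs_cqKernel_succ_sub_le h0 h1 hj q1 q2) (by linarith)

open MeasureTheory intervalIntegral in
theorem exists_abs_cqError_sub_le {α : ℝ} (h0 : 0 < α) (h1 : α < 1) :
    ∃ C, 0 ≤ C ∧ ∀ (f f1 f2 f3 : ℝ → ℝ) (M : ℝ) (n : ℕ), 2 ≤ n →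
      ContinuousOn f (Set.Ici 0) → (∀ s, 0 < s → HasDerivAt f (f1 s) s) →
      (∀ s, 0 < s → HasDerivAt f1 (f2 s) s) → (∀ s, 0 < s → HasDerivAt f2 (f3 s) s) →
      (∀ s, 0 < s → f1 s ≤ 0) →
      (∀ t, 0 < t → IntegrableOn (fun s => (t - s) ^ (-α) * f1 s) (Set.Ioo 0 t)) →
      (∀ s : ℝ, 0 ≤ s → s ≤ n → |f s - f 0| ≤ M) →
      (∀ s : ℝ, 0 < s → s ≤ n → |f1 s| ≤ M / s) → (∀ s : ℝ, 0 < s → s ≤ n → |f2 s| ≤ M / s ^ 2) →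
      (∀ s : ℝ, 0 < s → s ≤ n → |f3 s| ≤ M / s ^ 3) →
      |cqError α 1 f f1 (f 0) n - cqError α 1 f f1 (f 0) (n - 1)|
        ≤ C * M * (n : ℝ) ^ (-2 - α) := by
  obtain ⟨C, hC0, hC⟩ := exists_abs_sum_integral_cqKernel_mul_sub_le h0 h1
  have hG1 : 0 < 1 / Real.Gamma (1 - α) := one_div_pos.2 (Real.Gamma_pos_of_pos (sub_pos.2 h1))
  set γ := 1 / Real.Gamma (1 - α) with hγ
  have h1' : 0 < 1 - α := sub_pos.2 h1
  set D : ℕ → ℝ := fun n => γ * (2 + 2 * ((n : ℝ) ^ (1 - α) / (1 - α)))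
    + ∑ j ∈ Finset.range (n + 1), |cqWeight α j| with hD
  have hD0 : ∀ n, 0 ≤ D n := fun n => by positivity
  have four_pow : ∀ p : ℝ, p ≤ 3 → (4 : ℝ) ^ p ≤ 64 := fun p hp => by
    have := Real.rpow_le_rpow_of_exponent_le (show (1 : ℝ) ≤ 4 by norm_num) hp
    norm_num at this
    exact this
  refine ⟨8 * (D 2 + D 1) + (C + 256 * (γ * α) + 64 * (γ * (2 * α * (α + 1)))), by
    have := hD0 1; have := hD0 2; positivity, ?_⟩
  intro f f1 f2 f3 M n hn hf d0 d1 d2 hneg hi hM b1 b2 b3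
  have hM0 : 0 ≤ M := (abs_nonneg _).trans (hM 0 le_rfl (by positivity))
  obtain ⟨m, rfl⟩ : ∃ m, n = m + 1 := ⟨n - 1, by omega⟩
  rw [Nat.add_sub_cancel]
  have hN0 : (0 : ℝ) < (m + 1 : ℕ) := by positivity
  have hNp : 0 < ((m + 1 : ℕ) : ℝ) ^ (-2 - α) := by positivity
  have hr1 : 0 ≤ (C + 256 * (γ * α) + 64 * (γ * (2 * α * (α + 1)))) * M
      * ((m + 1 : ℕ) : ℝ) ^ (-2 - α) := by positivity
  rcases Nat.lt_or_ge m 2 with hm | hm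
  · obtain rfl : m = 1 := by omega
    have g2 := abs_cqError_one_le h0 h1 hf d0 hneg (n := 1 + 1) (by norm_num) hM b1
    have g1 := abs_cqError_one_le h0 h1 hf d0 hneg (n := 1) (by norm_num)
      (fun s hs hs' => hM s hs (by push_cast at *; linarith))
      (fun s hs hs' => b1 s hs (by push_cast at *; linarith))
    have p : 1 / 8 ≤ (((1 + 1 : ℕ) : ℝ)) ^ (-2 - α) := by
      have := Real.rpow_le_rpow_of_exponent_le (show (1 : ℝ) ≤ 2 by norm_num)
        (show (-3 : ℝ) ≤ -2 - α by linarith)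
      rw [Real.rpow_neg (by norm_num)] at this
      norm_num at this ⊢
      exact this
    have g2' : |cqError α 1 f f1 (f 0) (1 + 1)| ≤ D 2 * M := g2
    have g1' : |cqError α 1 f f1 (f 0) 1| ≤ D 1 * M := g1
    have q : 0 ≤ (D 2 + D 1) * M := mul_nonneg (add_nonneg (hD0 2) (hD0 1)) hM0
    have q2 := mul_le_mul_of_nonneg_left p q
    refine (abs_sub _ _).trans ?_
    rw [add_mul, add_mul]
    generalize ((1 + 1 : ℕ) : ℝ) ^ (-2 - α) = P at *
    linarith
  · set J := m / 2 with hJ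
    have hJ1 : 1 ≤ J := by omega
    have hJm : J ≤ m := by omega
    have hJ1' : (1 : ℝ) ≤ J := by exact_mod_cast hJ1
    have hJm' : 2 * (J : ℝ) ≤ m := by exact_mod_cast (by omega : 2 * J ≤ m)
    have hJN : (((m + 1 : ℕ) : ℝ)) / 4 ≤ J := by
      have : ((m + 1 : ℕ) : ℝ) ≤ 4 * J := by exact_mod_cast (by omega : m + 1 ≤ 4 * J)
      linarith
    have hm1 : ((m + 1 : ℕ) : ℝ) = m + 1 := by push_cast; ring
    have hm0 : (0 : ℝ) < m := by linarith
    have f1c : ContinuousOn f1 (Set.Ioi 0) := fun s hs => (d1 s hs).continuousAt.continuousWithinAt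
    rw [cqError_one_eq_sum hf d0 hneg _ (hi _ hN0), cqError_one_eq_sum hf d0 hneg _ (hi _ hm0),
      sum_range_succ_sub_sum_range_eq _ _ hJm]
    have near : |∑ j ∈ Finset.range J,
        ((∫ t in (j : ℝ)..(j + 1 : ℕ), cqKernel α j t * f1 ((m + 1 : ℕ) - t))
          - ∫ t in (j : ℝ)..(j + 1 : ℕ), cqKernel α j t * f1 (m - t))|
        ≤ C * M * ((m + 1 : ℕ) : ℝ) ^ (-2 - α) := by
      have h := hC f1 f2 f3 M (m + 1) J hJ1 (by omega) (by omega) hM0 d1 d2 b2 b3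
      refine le_of_eq_of_le ?_ h
      congr 1
      refine Finset.sum_congr rfl fun j hj => ?_
      have hj' : ((j + 1 : ℕ) : ℝ) ≤ J := by exact_mod_cast Finset.mem_range.1 hj
      have hjj : (j : ℝ) ≤ (j + 1 : ℕ) := by push_cast; linarith
      have hk := intervalIntegrable_cqKernel h1 j j (j + 1 : ℕ)
      have c : ∀ a : ℝ, m ≤ a → ContinuousOn (fun t => f1 (a - t)) (Set.uIcc (j : ℝ) (j + 1 : ℕ)) :=
        fun a ha => f1c.comp (by fun_prop) fun t ht => by
          rw [Set.uIcc_of_le hjj] at ht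
          have := ht.2
          exact show 0 < a - t by linarith
      rw [← intervalIntegral.integral_sub (hk.mul_continuousOn (c _ (by rw [hm1]; linarith)))
        (hk.mul_continuousOn (c _ le_rfl))]
      refine integral_congr fun t _ => ?_
      simp only [hm1, add_sub_cancel_right]
      ring
    have mid : |∫ t in (J : ℝ)..(J + 1 : ℕ), cqKernel α J t * f1 ((m + 1 : ℕ) - t)|
        ≤ 256 * (γ * α) * M * ((m + 1 : ℕ) : ℝ) ^ (-2 - α) := by
      have hjj : (J : ℝ) ≤ (J + 1 : ℕ) := by push_cast; linarith
      have h := norm_integral_le_of_norm_le_const (a := (J : ℝ)) (b := (J + 1 : ℕ))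
        (f := fun t => cqKernel α J t * f1 ((m + 1 : ℕ) - t))
        (C := γ * α * (64 * ((m + 1 : ℕ) : ℝ) ^ (-α - 1)) * (4 * M / (m + 1 : ℕ))) fun t ht => ?_
      · simp only [Nat.cast_add, Nat.cast_one, add_sub_cancel_left, abs_one, mul_one] at h ⊢
        refine h.trans_eq ?_
        rw [show -2 - α = (-α - 1) - 1 by ring, 
          Real.rpow_sub_one (show (m : ℝ) + 1 ≠ 0 by positivity) (-α - 1)]
        field_simp
        ring
      · rw [Set.uIoc_of_le hjj] at ht
        have t1 := ht.1.le
        have t2 := ht.2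
        push_cast at t2
        rw [norm_mul]
        refine mul_le_mul ?_ ?_ (norm_nonneg _) (by positivity)
        · refine (abs_cqKernel_le h0 h1 hJ1 t1 t2).trans ?_
          have := rpow_neg_le_of_div_four_le hN0 hJN (show 0 ≤ α + 1 by linarith)
          rw [show -(α + 1) = -α - 1 by ring] at this
          have h4 := four_pow (α + 1) (by linarith)
          refine mul_le_mul_of_nonneg_left (this.trans ?_) (by positivity)
          gcongr
        · have := abs_le_of_abs_le_div_pow (k := 1) hN0
            (fun s hs hs' => by simpa using b1 s hs hs') hM0
            (s := (m + 1 : ℕ) - t) (by rw [hm1]; linarith) (by linarith)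
          simpa using this
    have far : |∑ j ∈ Finset.Ico J m,
        ((∫ t in ((j + 1 : ℕ) : ℝ)..(j + 1 + 1 : ℕ), cqKernel α (j + 1) t * f1 ((m + 1 : ℕ) - t))
          - ∫ t in (j : ℝ)..(j + 1 : ℕ), cqKernel α j t * f1 (m - t))|
        ≤ 64 * (γ * (2 * α * (α + 1))) * M * ((m + 1 : ℕ) : ℝ) ^ (-2 - α) := by
      have hanti : AntitoneOn f (Set.Ici 0) := by
        refine antitoneOn_of_deriv_nonpos (convex_Ici 0) hf ?_ ?_
        · intro s hs
          rw [interior_Ici] at hs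
          exact (d0 s hs).differentiableAt.differentiableWithinAt
        · intro s hs
          rw [interior_Ici] at hs
          rw [(d0 s hs).deriv]
          exact hneg s hs
      calc _ ≤ ∑ j ∈ Finset.Ico J m, γ * (2 * α * (α + 1)) * (64 * ((m + 1 : ℕ) : ℝ) ^ (-2 - α))
            * (f ((m + 1 : ℕ) - (j + 1 + 1 : ℕ)) - f ((m + 1 : ℕ) - (j + 1 : ℕ))) := by
            refine (Finset.abs_sum_le_sum_abs _ _).trans (Finset.sum_le_sum fun j hj => ?_)
            obtain ⟨j1, j2⟩ := Finset.mem_Ico.1 hj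
            have j1' : (J : ℝ) ≤ j := by exact_mod_cast j1
            have j2' : (j : ℝ) + 1 ≤ m := by exact_mod_cast j2
            refine (integral_cqKernel_sub_integral_cqKernel hf d0 hneg h0 h1 (hJ1.trans j1)
              j2).trans (mul_le_mul_of_nonneg_right ?_ (sub_nonneg.2 (hanti ?_ ?_ ?_)))
            · have := rpow_neg_le_of_div_four_le hN0 (hJN.trans j1') (show 0 ≤ α + 2 by linarith)
              rw [show -(α + 2) = -2 - α by ring] at this
              rw [show -α - 2 = -2 - α by ring]
              have h4 := four_pow (α + 2) (by linarith)
              refine mul_le_mul_of_nonneg_left (this.trans ?_) (by positivity)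
              gcongr
            · exact show (0 : ℝ) ≤ (m + 1 : ℕ) - (j + 1 + 1 : ℕ) by push_cast; linarith
            · exact show (0 : ℝ) ≤ (m + 1 : ℕ) - (j + 1 : ℕ) by push_cast; linarith
            · push_cast; linarith
        _ = γ * (2 * α * (α + 1)) * (64 * ((m + 1 : ℕ) : ℝ) ^ (-2 - α))
            * (f ((m + 1 : ℕ) - (m + 1 : ℕ)) - f ((m + 1 : ℕ) - (J + 1 : ℕ))) := by
            rw [← Finset.mul_sum,
              Finset.sum_Ico_sub (fun j : ℕ => f ((m + 1 : ℕ) - (j + 1 : ℕ))) hJm]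
        _ ≤ γ * (2 * α * (α + 1)) * (64 * ((m + 1 : ℕ) : ℝ) ^ (-2 - α)) * M := by
            rw [sub_self]
            refine mul_le_mul_of_nonneg_left ?_ (by positivity)
            refine (le_abs_self _).trans ?_
            rw [abs_sub_comm]
            exact hM _ (by push_cast; linarith) (by push_cast; linarith)
        _ = _ := by ring
    have hD21 : 0 ≤ 8 * (D 2 + D 1) * M * ((m + 1 : ℕ) : ℝ) ^ (-2 - α) := by
      have := hD0 1
      have := hD0 2
      positivity
    refine (abs_add_three _ _ _).trans ?_
    simp only [add_mul] at hD21 hr1 ⊢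
    linarith

theorem ml_rpow_zero {α : ℝ} (h0 : 0 < α) (h1 : α < 1) (l : ℝ) : ml α 0 (l * (0 : ℝ) ^ α) = 1 := by
  rw [Real.zero_rpow h0.ne', mul_zero, ml_zero h0 h1, mlCoeff_zero_zero]

theorem exists_abs_cqError_ml_sub_le {α : ℝ} (h0 : 0 < α) (h1 : α < 1) :
    ∃ C, 0 ≤ C ∧ ∀ (l : ℝ) (n : ℕ), 0 < l → 2 ≤ n →
      |cqError α 1 (fun s => ml α 0 (l * s ^ α)) (fun s => ml α 1 (l * s ^ α) / s) 1 n
        - cqError α 1 (fun s => ml α 0 (l * s ^ α)) (fun s => ml α 1 (l * s ^ α) / s) 1 (n - 1)|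
        ≤ C * min 1 (l * (n : ℝ) ^ α) * (n : ℝ) ^ (-2 - α) := by
  obtain ⟨C, hC0, hC⟩ := exists_abs_cqError_sub_le h0 h1
  obtain ⟨M0, hM0, b0⟩ := exists_abs_ml_sub_le_min h0 h1 0
  obtain ⟨M1, hM1, b1⟩ := exists_abs_ml_sub_le_min h0 h1 1
  obtain ⟨M2, hM2, b2⟩ := exists_abs_ml_sub_le_min h0 h1 2
  obtain ⟨M3, hM3, b3⟩ := exists_abs_ml_sub_le_min h0 h1 3
  simp only [mlCoeff_zero_zero] at b0
  simp only [mlCoeff_succ_zero, sub_zero] at b1 b2 b3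
  refine ⟨C * (M0 + 2 * M1 + 3 * M2 + M3), by positivity, fun l n hl hn => ?_⟩
  have hd := fun (j : ℕ) (s : ℝ) (hs : 0 < s) => hasDerivAt_ml_rpow h0 h1 hl hs j
  set m := min 1 (l * (n : ℝ) ^ α) with hm
  have hm0 : 0 ≤ m := le_min zero_le_one (by positivity)
  have hmon : ∀ s : ℝ, 0 ≤ s → s ≤ n → 0 ≤ l * s ^ α ∧ min 1 (l * s ^ α) ≤ m := fun s hs hs' =>
    ⟨by positivity, min_le_min le_rfl (by gcongr)⟩
  have q0 : ∀ s : ℝ, 0 ≤ s → s ≤ n → |ml α 0 (l * s ^ α) - 1| ≤ M0 * m := fun s hs hs' =>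
    (b0 _ (hmon s hs hs').1).trans (mul_le_mul_of_nonneg_left (hmon s hs hs').2 hM0)
  have q1 : ∀ s : ℝ, 0 ≤ s → s ≤ n → |ml α 1 (l * s ^ α)| ≤ M1 * m := fun s hs hs' =>
    (b1 _ (hmon s hs hs').1).trans (mul_le_mul_of_nonneg_left (hmon s hs hs').2 hM1)
  have q2 : ∀ s : ℝ, 0 ≤ s → s ≤ n → |ml α 2 (l * s ^ α)| ≤ M2 * m := fun s hs hs' =>
    (b2 _ (hmon s hs hs').1).trans (mul_le_mul_of_nonneg_left (hmon s hs hs').2 hM2)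
  have q3 : ∀ s : ℝ, 0 ≤ s → s ≤ n → |ml α 3 (l * s ^ α)| ≤ M3 * m := fun s hs hs' =>
    (b3 _ (hmon s hs hs').1).trans (mul_le_mul_of_nonneg_left (hmon s hs hs').2 hM3)
  have r0 := mul_nonneg hM0 hm0
  have r1 := mul_nonneg hM1 hm0
  have r2 := mul_nonneg hM2 hm0
  have r3 := mul_nonneg hM3 hm0
  have h := hC (fun s => ml α 0 (l * s ^ α)) (fun s => ml α 1 (l * s ^ α) / s)
    (fun s => (ml α 2 (l * s ^ α) - ml α 1 (l * s ^ α)) / s ^ 2)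
    (fun s => (ml α 3 (l * s ^ α) - 3 * ml α 2 (l * s ^ α) + 2 * ml α 1 (l * s ^ α)) / s ^ 3)
    ((M0 + 2 * M1 + 3 * M2 + M3) * m) n hn (continuous_ml_rpow h0 h1 l 0).continuousOn
    (fun s hs => hd 0 s hs) ?_ ?_ ?_ (fun t ht => integrableOn_ml h0 h1 hl ht 0) ?_ ?_ ?_ ?_
  · simp only [ml_rpow_zero h0 h1] at h
    refine h.trans_eq ?_
    ring
  · intro s hs
    convert! (hd 1 s hs).div (hasDerivAt_id s) hs.ne' using 1
    simp only [id]
    field_simp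
  · intro s hs
    convert! ((hd 2 s hs).sub (hd 1 s hs)).div (hasDerivAt_pow 2 s) (pow_ne_zero 2 hs.ne') using 1
    simp only [Pi.sub_apply]
    field_simp
    norm_num
    ring
  · intro s hs
    exact div_nonpos_of_nonpos_of_nonneg (ml_one_nonpos h0 h1 (by positivity)) hs.le
  · intro s hs hs'
    have := q0 s hs hs'
    simp only [ml_rpow_zero h0 h1]
    linarith
  · intro s hs hs'
    rw [abs_div, abs_of_pos hs]
    have := q1 s hs.le hs'
    gcongr
    linarith
  · intro s hs hs'
    rw [abs_div, abs_of_pos (pow_pos hs 2)]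
    have p1 := abs_le.1 (q1 s hs.le hs')
    have p2 := abs_le.1 (q2 s hs.le hs')
    gcongr
    exact abs_le.2 ⟨by linarith, by linarith⟩
  · intro s hs hs'
    rw [abs_div, abs_of_pos (pow_pos hs 3)]
    have p1 := abs_le.1 (q1 s hs.le hs')
    have p2 := abs_le.1 (q2 s hs.le hs')
    have p3 := abs_le.1 (q3 s hs.le hs')
    gcongr
    exact abs_le.2 ⟨by linarith, by linarith⟩

theorem caputo_ml {α l t : ℝ} (h0 : 0 < α) (h1 : α < 1) (ht : 0 < t) :
    caputo α (fun s => ml α 1 (l * s ^ α) / s) t = -(l * ml α 0 (l * t ^ α)) := by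
  have := Real.Gamma_pos_of_pos (sub_pos.2 h1)
  rw [caputo]
  simp only [smul_eq_mul]
  rw [integral_ml h0 h1 ht 0]
  simp
  field_simp

theorem cqError_ml {α l τ : ℝ} (h0 : 0 < α) (h1 : α < 1) (hτ : 0 < τ) {n : ℕ} (hn : 1 ≤ n) :
    cqError α τ (fun s => ml α 0 (l * s ^ α)) (fun s => ml α 1 (l * s ^ α) / s) 1 n
      = τ ^ (-α) * cqError α 1 (fun s => ml α 0 (l * τ ^ α * s ^ α))
        (fun s => ml α 1 (l * τ ^ α * s ^ α) / s) 1 n := by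
  have hn0 : (0 : ℝ) < n := by exact_mod_cast hn
  have e : ∀ k : ℕ, l * τ ^ α * ((k : ℝ) * 1) ^ α = l * ((k : ℝ) * τ) ^ α := fun k => by
    rw [Real.mul_rpow k.cast_nonneg hτ.le, mul_one]
    ring
  rw [cqError, cqError, caputo_ml h0 h1 (by positivity), caputo_ml h0 h1 (by positivity)]
  simp only [e, Real.one_rpow, smul_eq_mul, mul_sub, Finset.sum_sub_distrib]
  have : τ ^ (-α) * τ ^ α = 1 := by rw [← Real.rpow_add hτ]; simp
  linear_combination (l * ml α 0 (l * ((n : ℝ) * τ) ^ α)) * this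

theorem exists_abs_rpow_mul_cqError_ml_sub_le {α β : ℝ} (h0 : 0 < α) (h1 : α < 1) (hβ0 : 0 ≤ β)
    (hβ1 : β ≤ 1) :
    ∃ C, 0 < C ∧ ∀ (l τ : ℝ) (n : ℕ), 0 < l → 0 < τ → 2 ≤ n →
      |l ^ (-β) * (τ⁻¹ *
        (cqError α τ (fun s => ml α 0 (l * s ^ α)) (fun s => ml α 1 (l * s ^ α) / s) 1 n
        - cqError α τ (fun s => ml α 0 (l * s ^ α)) (fun s => ml α 1 (l * s ^ α) / s) 1 (n - 1)))|
        ≤ C * τ * ((n : ℝ) * τ) ^ (-2 - (1 - β) * α) := by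
  obtain ⟨C, hC0, hC⟩ := exists_abs_cqError_ml_sub_le h0 h1
  refine ⟨C + 1, by linarith, fun l τ n hl hτ hn => ?_⟩
  have hn0 : (0 : ℝ) < n := by exact_mod_cast (by omega : 0 < n)
  have hτa : 0 < τ ^ α := by positivity
  rw [cqError_ml h0 h1 hτ (by omega : 1 ≤ n), cqError_ml h0 h1 hτ (by omega : 1 ≤ n - 1), ← mul_sub,
    abs_mul, abs_mul, abs_mul, abs_of_pos (by positivity : 0 < l ^ (-β)),
    abs_of_pos (inv_pos.2 hτ), abs_of_pos (by positivity : 0 < τ ^ (-α))]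
  have hmin : min 1 (l * τ ^ α * (n : ℝ) ^ α) ≤ l ^ β * ((n : ℝ) * τ) ^ (α * β) := by
    have e : l ^ β * ((n : ℝ) * τ) ^ (α * β) = (l * τ ^ α * (n : ℝ) ^ α) ^ β := by
      rw [Real.rpow_mul (by positivity), ← Real.mul_rpow hl.le (by positivity),
        Real.mul_rpow hn0.le hτ.le]
      ring_nf
    rw [e]
    have hx : 0 < l * τ ^ α * (n : ℝ) ^ α := by positivity
    set x := l * τ ^ α * (n : ℝ) ^ α with hx'
    rcases le_total x 1 with h | h
    · refine (min_le_right _ _).trans ?_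
      simpa using Real.rpow_le_rpow_of_exponent_ge hx h hβ1
    · exact (min_le_left _ _).trans (Real.one_le_rpow h hβ0)
  have h := hC (l * τ ^ α) n (by positivity) hn
  calc _ ≤ l ^ (-β) * (τ⁻¹ * (τ ^ (-α) * (C * (l ^ β * ((n : ℝ) * τ) ^ (α * β))
        * (n : ℝ) ^ (-2 - α)))) := by
        gcongr
        refine h.trans ?_
        gcongr
    _ = C * τ * ((n : ℝ) * τ) ^ (-2 - (1 - β) * α) := by
        have a1 : l ^ (-β) * l ^ β = 1 := by rw [← Real.rpow_add hl]; simp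
        have a2 : τ * τ ^ (-2 - α) = τ⁻¹ * τ ^ (-α) := by
          rw [sub_eq_add_neg, Real.rpow_add hτ, ← mul_assoc, Real.rpow_neg hτ.le 2]
          norm_cast
          field_simp
        rw [show -2 - (1 - β) * α = α * β + (-2 - α) by ring, Real.rpow_add (by positivity),
          Real.mul_rpow hn0.le hτ.le (z := -2 - α)]
        linear_combination (C * ((n : ℝ) * τ) ^ (α * β) * (n : ℝ) ^ (-2 - α)) *
          ((τ⁻¹ * τ ^ (-α)) * a1 - a2)
    _ ≤ _ := by
        gcongr
        linarith

theorem ContinuousLinearMap.spectrum_real_finite {V : Type*} [NormedAddCommGroup V]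
    [InnerProductSpace ℂ V] [FiniteDimensional ℂ V] (A : V →L[ℂ] V) : (spectrum ℝ A).Finite := by
  have h := (Module.End.finite_spectrum (A : V →ₗ[ℂ] V)).preimage
    (f := algebraMap ℝ ℂ) (FaithfulSMul.algebraMap_injective ℝ ℂ).injOn
  rwa [← ContinuousLinearMap.spectrum_eq, spectrum.preimage_algebraMap] at h

theorem ContinuousLinearMap.aeval_apply_of_apply_eq_smul {V : Type*} [NormedAddCommGroup V]
    [InnerProductSpace ℂ V] {A : V →L[ℂ] V} {x : V} {r : ℝ} (h : A x = r • x)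
    (q : Polynomial ℝ) : Polynomial.aeval A q x = q.eval r • x := by
  induction q using Polynomial.induction_on' with
  | add p q hp hq => simp [hp, hq, add_smul]
  | monomial n a =>
    have hn : (A ^ n) x = r ^ n • x := by
      induction n with
      | zero => simp
      | succ n ih =>
        rw [pow_succ, mul_apply_eq_comp, h, map_smul_of_tower, ih, smul_smul, pow_succ']
    simp [Polynomial.aeval_monomial, hn, smul_smul, Algebra.algebraMap_eq_smul_one]

theorem ContinuousLinearMap.cfc_apply_of_apply_eq_smul {V : Type*} [NormedAddCommGroup V]
    [InnerProductSpace ℂ V] [FiniteDimensional ℂ V] {A : V →L[ℂ] V} (hA : IsSelfAdjoint A) {x : V}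
    {r : ℝ} (h : A x = r • x) (f : ℝ → ℝ) : cfc f A x = f r • x := by
  have hf := A.spectrum_real_finite
  set S := insert r hf.toFinset with hS
  set q := Lagrange.interpolate S id f with hq
  have he : ∀ y ∈ S, q.eval y = f y := fun y hy =>
    Lagrange.eval_interpolate_at_node f Function.injective_id.injOn hy
  rw [← he r (by simp [hS]), ← aeval_apply_of_apply_eq_smul h q, ← cfc_polynomial q A hA]
  congr 1
  exact cfc_congr fun y hy => (he y (by simp [hS, hy])).symm

theorem OrthonormalBasis.norm_sum_smul_le {ι V : Type*} [Fintype ι] [NormedAddCommGroup V]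
    [InnerProductSpace ℂ V] (b : OrthonormalBasis ι ℂ V) (v : V) {a : ι → ℝ} {K : ℝ} (hK : 0 ≤ K)
    (ha : ∀ i, |a i| ≤ K) : ‖∑ i, a i • (⟪b i, v⟫ • b i)‖ ≤ K * ‖v‖ := by
  have e : ∑ i, a i • (⟪b i, v⟫ • b i) = b.repr.symm (WithLp.toLp 2 fun i => a i • ⟪b i, v⟫) := by
    rw [← b.sum_repr_symm]
    exact Finset.sum_congr rfl fun i _ => (smul_assoc _ _ _).symm
  rw [e, LinearIsometryEquiv.norm_map]
  refine abs_le_of_sq_le_sq' ?_ (by positivity) |>.2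
  rw [EuclideanSpace.norm_sq_eq, mul_pow, ← b.sum_sq_norm_inner_right v, Finset.mul_sum]
  refine Finset.sum_le_sum fun i _ => ?_
  simp only [norm_smul, mul_pow, Real.norm_eq_abs]
  gcongr
  exact ha i

theorem eq_zero_of_caputo_add_eq_zero {α : ℝ} (h0 : 0 < α) (h1 : α < 1) {V : Type}
    [NormedAddCommGroup V] [InnerProductSpace ℂ V] [CompleteSpace V] {A : V →L[ℂ] V}
    (hA : ∀ x : V, x ≠ 0 → 0 < (⟪A x, x⟫).re) {w w' : ℝ → V} (hc : ContinuousOn w (Set.Ici 0))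
    (hw : w 0 = 0) (hd : ∀ t, 0 < t → HasDerivAt w (w' t) t)
    (hi : ∀ t, 0 < t →
      MeasureTheory.IntegrableOn (fun s => (t - s) ^ (-α) • w' s) (Set.Ioo 0 t))
    (he : ∀ t, 0 < t → caputo α w' t + A (w t) = 0) {T : ℝ} (hT : 0 ≤ T) : w T = 0 := by
  obtain ⟨t, ⟨ht0, htT⟩, hmax⟩ := isCompact_Icc.exists_isMaxOn (Set.nonempty_Icc.2 hT)
    (hc.mono Set.Icc_subset_Ici_self).norm
  have hmax : ∀ s ∈ Set.Icc 0 T, ‖w s‖ ≤ ‖w t‖ := fun s hs => hmax hs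
  suffices w t = 0 by simpa [this] using hmax T ⟨hT, le_rfl⟩
  rcases ht0.eq_or_lt with rfl | ht
  · exact hw
  by_contra hx
  have hG := Real.Gamma_pos_of_pos (sub_pos.2 h1)
  have hA := hA _ hx
  set L : V →L[ℝ] ℝ := Complex.reCLM ∘L (innerSL ℂ (w t)).restrictScalars ℝ with hL
  have hLx : ∀ x, L x = (⟪w t, x⟫).re := fun x => rfl
  have hint : ∫ s in Set.Ioo 0 t, (t - s) ^ (-α) * L (w' s)
      = -(Real.Gamma (1 - α) * (⟪A (w t), w t⟫).re) := by
    have := L.integral_comp_comm (hi t ht)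
    simp only [map_smul, smul_eq_mul] at this
    rw [this]
    have hh := he t ht
    rw [caputo, add_eq_zero_iff_eq_neg, one_div, inv_smul_eq_iff₀ hG.ne'] at hh
    rw [hh, map_smul, map_neg, hLx, ← inner_conj_symm, Complex.conj_re, smul_eq_mul, mul_neg]
  have := rpow_mul_sub_le_integral_of_forall_le h0 h1 ht (p := fun s => L (w s))
    (p' := fun s => L (w' s))
    (L.continuous.comp_continuousOn (hc.mono Set.Icc_subset_Ici_self))
    (fun s hs _ => L.hasFDerivAt.comp_hasDerivAt s (hd s hs)) (fun s hs => ?_) ?_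
  · rw [hint, hw, map_zero, sub_zero, hLx, ← RCLike.re_eq_complex_re, inner_self_eq_norm_sq] at this
    refine absurd (le_trans (by positivity) this) (not_le.2 (neg_neg_of_pos ?_))
    exact mul_pos hG hA
  · simp only [hLx, ← RCLike.re_eq_complex_re]
    refine (re_inner_le_norm _ _).trans ?_
    rw [inner_self_eq_norm_mul_norm]
    gcongr
    exact hmax s ⟨hs.1, hs.2.trans htT⟩
  · have := L.integrable_comp (hi t ht)
    simp only [map_smul, smul_eq_mul] at this
    exact this

theorem caputo_sum_smul {ι : Type*} [Fintype ι] {α : ℝ} {V : Type} [NormedAddCommGroup V]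
    [NormedSpace ℝ V] [CompleteSpace V] {f : ι → ℝ → ℝ} {t : ℝ} (c : ι → V)
    (hf : ∀ i, MeasureTheory.IntegrableOn (fun s => (t - s) ^ (-α) * f i s) (Set.Ioo 0 t)) :
    caputo α (fun s => ∑ i, f i s • c i) t = ∑ i, caputo α (f i) t • c i := by
  simp only [caputo, Finset.smul_sum, smul_smul, smul_eq_mul]
  rw [MeasureTheory.integral_finsetSum _ fun i _ => (hf i).smul_const _, Finset.smul_sum]
  exact Finset.sum_congr rfl fun i _ => by rw [integral_smul_const, smul_smul]

theorem cqError_sum_smul {ι : Type*} [Fintype ι] {α τ : ℝ} {V : Type} [NormedAddCommGroup V]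
    [NormedSpace ℝ V] [CompleteSpace V] {f f' : ι → ℝ → ℝ} {n : ℕ} (c : ι → V)
    (hf : ∀ i, MeasureTheory.IntegrableOn (fun s => ((n : ℝ) * τ - s) ^ (-α) * f' i s)
      (Set.Ioo 0 ((n : ℝ) * τ))) :
    cqError α τ (fun s => ∑ i, f i s • c i) (fun s => ∑ i, f' i s • c i) (∑ i, c i) n
      = ∑ i, cqError α τ (f i) (f' i) 1 n • c i := by
  simp only [cqError, caputo_sum_smul c hf, sub_smul, Finset.sum_sub_distrib, smul_eq_mul]
  congr 1
  simp only [mul_smul, Finset.sum_smul, ← Finset.smul_sum]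
  rw [Finset.sum_comm]
  simp only [← Finset.smul_sum, sub_smul, Finset.sum_sub_distrib, one_smul]

theorem cqError_congr {α τ : ℝ} {V : Type} [NormedAddCommGroup V] [NormedSpace ℝ V]
    {u u' w w' : ℝ → V} {v : V} {n : ℕ} (hu : ∀ t, 0 ≤ t → u t = w t) (hτ : 0 ≤ τ)
    (hu' : caputo α u' ((n : ℝ) * τ) = caputo α w' ((n : ℝ) * τ)) :
    cqError α τ u u' v n = cqError α τ w w' v n := by
  simp only [cqError, hu', hu _ (mul_nonneg (Nat.cast_nonneg _) hτ)]

theorem integrableOn_rpow_smul_of_integrableOn_rpow_mul_norm {α t : ℝ} {V : Type*}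
    [NormedAddCommGroup V] [NormedSpace ℝ V] [FiniteDimensional ℝ V] {u u' : ℝ → V}
    (hd : ∀ s, 0 < s → HasDerivAt u (u' s) s)
    (hi : MeasureTheory.IntegrableOn (fun s => (t - s) ^ (-α) * ‖u' s‖) (Set.Ioo 0 t)) :
    MeasureTheory.IntegrableOn (fun s => (t - s) ^ (-α) • u' s) (Set.Ioo 0 t) := by
  have : CompleteSpace V := FiniteDimensional.complete ℝ V
  refine MeasureTheory.Integrable.mono hi ?_ ?_
  · refine MeasureTheory.AEStronglyMeasurable.smul 
      (Measurable.pow_const (by fun_prop) _).aestronglyMeasurable ?_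
    refine (aestronglyMeasurable_deriv u _).congr ?_
    filter_upwards [MeasureTheory.ae_restrict_mem measurableSet_Ioo] with s hs
    exact (hd s hs.1).deriv
  · filter_upwards with s
    simp [norm_smul]

theorem eq_sum_ml_smul {α : ℝ} (h0 : 0 < α) (h1 : α < 1) {ι : Type*} [Fintype ι] {V : Type}
    [NormedAddCommGroup V] [InnerProductSpace ℂ V] [CompleteSpace V] {A : V →L[ℂ] V}
    (hA : ∀ x : V, x ≠ 0 → 0 < (⟪A x, x⟫).re) {c : ι → V} {l : ι → ℝ} (hl : ∀ i, 0 < l i)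
    (hc : ∀ i, A (c i) = l i • c i) {u u' : ℝ → V} (hu : ContinuousOn u (Set.Ici 0))
    (hu0 : u 0 = ∑ i, c i) (hd : ∀ t, 0 < t → HasDerivAt u (u' t) t)
    (hi : ∀ t, 0 < t →
      MeasureTheory.IntegrableOn (fun s => (t - s) ^ (-α) • u' s) (Set.Ioo 0 t))
    (he : ∀ t, 0 < t → caputo α u' t + A (u t) = 0) {t : ℝ} (ht : 0 ≤ t) :
    u t = ∑ i, ml α 0 (l i * t ^ α) • c i := by
  rw [← sub_eq_zero]
  have hI : ∀ t : ℝ, 0 < t → MeasureTheory.IntegrableOn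
      (fun s => (t - s) ^ (-α) • ∑ i, (ml α 1 (l i * s ^ α) / s) • c i) (Set.Ioo 0 t) := by
    intro t ht
    simp only [Finset.smul_sum, smul_smul]
    exact MeasureTheory.integrable_finsetSum _ fun i _ =>
      (integrableOn_ml h0 h1 (hl i) ht 0).smul_const _
  refine eq_zero_of_caputo_add_eq_zero h0 h1 hA
    (w := fun t => u t - ∑ i, ml α 0 (l i * t ^ α) • c i)
    (w' := fun t => u' t - ∑ i, (ml α 1 (l i * t ^ α) / t) • c i) ?_ ?_ ?_ ?_ ?_ ht
  · refine hu.sub (Continuous.continuousOn ?_)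
    exact continuous_finsetSum _ fun i _ => (continuous_ml_rpow h0 h1 _ _).smul continuous_const
  · simp [ml_rpow_zero h0 h1, hu0]
  · intro t ht
    refine (hd t ht).sub (HasDerivAt.fun_sum fun i _ => ?_)
    exact (hasDerivAt_ml_rpow h0 h1 (hl i) ht 0).smul_const _
  · intro t ht
    simp only [smul_sub]
    exact (hi t ht).sub (hI t ht)
  · intro t ht
    have e : caputo α (fun t => u' t - ∑ i, (ml α 1 (l i * t ^ α) / t) • c i) t
        = caputo α u' t - caputo α (fun t => ∑ i, (ml α 1 (l i * t ^ α) / t) • c i) t := by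
      simp only [caputo, smul_sub]
      rw [MeasureTheory.integral_sub (hi t ht) (hI t ht), smul_sub]
    rw [e, caputo_sum_smul c fun i => integrableOn_ml h0 h1 (hl i) ht 0, map_sub, map_sum,
      ← sub_eq_zero.2 (he t ht)]
    simp only [zero_add, caputo_ml h0 h1 ht, ContinuousLinearMap.map_smul_of_tower, hc, smul_smul, neg_smul, mul_comm (ml _ _ _)]
    simp

/-- Bound on the backward difference of the consistency error of the backward Euler CQ:
`‖A^{-β} (g(t_n) - g(t_{n-1}))/τ‖ ≤ c τ t_n^{-2-(1-β)α} ‖v‖`. -/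
theorem cq_consistency_difference_bound (α β : ℝ) (hα0 : 0 < α) (hα1 : α < 1)
    (hβ0 : 0 ≤ β) (hβ1 : β ≤ 1) :
    ∃ c : ℝ, 0 < c ∧
      ∀ (V : Type) (_ : NormedAddCommGroup V) (_ : InnerProductSpace ℂ V)
        (_ : FiniteDimensional ℂ V) (_ : Nontrivial V)
        (A : V →L[ℂ] V), IsSelfAdjoint A →
        (∀ x : V, x ≠ 0 → 0 < (⟪A x, x⟫).re) →
        ∀ (v : V) (u u' : ℝ → V),
        ContinuousOn u (Set.Ici 0) → u 0 = v →
        (∀ t : ℝ, 0 < t → HasDerivAt u (u' t) t) →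
        (∀ t : ℝ, 0 < t →
          MeasureTheory.IntegrableOn (fun s => (t - s) ^ (-α) * ‖u' s‖) (Set.Ioo 0 t)) →
        (∀ t : ℝ, 0 < t → caputo α u' t + A (u t) = 0) →
        ∀ τ : ℝ, 0 < τ → ∀ n : ℕ, 2 ≤ n →
          ‖opRPow A (-β) (τ⁻¹ • (cqError α τ u u' v n - cqError α τ u u' v (n - 1)))‖
            ≤ c * τ * ((n : ℝ) * τ) ^ (-2 - (1 - β) * α) * ‖v‖ := by
  obtain ⟨C, hC0, hC⟩ := exists_abs_rpow_mul_cqError_ml_sub_le hα0 hα1 hβ0 hβ1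
  refine ⟨C, hC0, fun V _ _ _ _ A hA hpos v u u' hu hu0 hd hi he τ hτ n hn => ?_⟩
  have hR : FiniteDimensional ℝ V := FiniteDimensional.complexToReal V
  have hcs : CompleteSpace V := FiniteDimensional.complete ℂ V
  have hS : (A : V →ₗ[ℂ] V).IsSymmetric := hA.isSymmetric
  set b := hS.eigenvectorBasis rfl with hb
  set l := hS.eigenvalues rfl with hl
  have hAb : ∀ i, A (b i) = l i • b i := fun i => hS.apply_eigenvectorBasis rfl i
  have hl0 : ∀ i, 0 < l i := fun i => by
    have := hpos (b i) (b.orthonormal.ne_zero i)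
    rw [hAb, ← Complex.coe_smul, inner_smul_left] at this
    simpa [b.orthonormal.norm_eq_one i] using this
  have hAc : ∀ i, A (⟪b i, v⟫ • b i) = l i • (⟪b i, v⟫ • b i) := fun i => by
    rw [map_smul, hAb, smul_comm]
  have hi' := fun t ht => integrableOn_rpow_smul_of_integrableOn_rpow_mul_norm hd (hi t ht)
  have hv : ∑ i, ⟪b i, v⟫ • b i = v := b.sum_repr' v
  have hsol := fun (t : ℝ) (ht : 0 ≤ t) =>
    eq_sum_ml_smul hα0 hα1 hpos hl0 hAc hu (hu0.trans hv.symm) hd hi' he ht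
  have herr : ∀ k : ℕ, 1 ≤ k → cqError α τ u u' v k
      = ∑ i, cqError α τ (fun s => ml α 0 (l i * s ^ α)) (fun s => ml α 1 (l i * s ^ α) / s) 1 k
        • (⟪b i, v⟫ • b i) := by
    intro k hk
    have hkτ : 0 < (k : ℝ) * τ := by
      have : (0 : ℝ) < k := by exact_mod_cast hk
      positivity
    have hI := fun i => integrableOn_ml hα0 hα1 (hl0 i) hkτ 0
    rw [← cqError_sum_smul _ hI, hv]
    refine cqError_congr hsol hτ.le ?_
    rw [eq_neg_of_add_eq_zero_left (he _ hkτ), hsol _ hkτ.le, caputo_sum_smul _ hI]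
    simp only [zero_add, caputo_ml hα0 hα1 hkτ, map_sum, ContinuousLinearMap.map_smul_of_tower, hAc, smul_smul, neg_smul,
      mul_comm (ml _ _ _), Finset.sum_neg_distrib]
  rw [herr n (by omega), herr (n - 1) (by omega), ← Finset.sum_sub_distrib, Finset.smul_sum,
    map_sum]
  simp only [← sub_smul, smul_smul (_ : ℝ) (_ : ℝ), ContinuousLinearMap.map_smul_of_tower, opRPow,
    ContinuousLinearMap.cfc_apply_of_apply_eq_smul hA (hAc _)]
  refine b.norm_sum_smul_le v (K := C * τ * ((n : ℝ) * τ) ^ (-2 - (1 - β) * α)) (by positivity) fun i => ?_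
  rw [mul_comm]
  exact hC (l i) τ n (hl0 i) hτ hn
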